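/- In the mixed even p-spin short-range model, assume the polynomial volume growth condition: there are constants A, θ > 0 independent of N such that max_{i∈[N]} |B_r(i)| ≤ A r^θ for all r ∈ ℕ. Then there exists a constant C > 0 depending only on A and θ such that for every t > 0, every 0 ≤ β < ∞, and both the continuous and the discrete perturbation, E⟨R(σ,τ)²⟩_t ≤ 1/N + C/(N t^θ). -/

import Mathlib

open MeasureTheory ProbabilityTheory Real Finset

noncomputable section

/-! ### Basic objects: spins, Hermite polynomials, Gaussian measures -/

/-- The `±1` spin value attached to a Boolean. -/
def spin (b : Bool) : ℝ := if b then 1 else -1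

/-- Normalized Hermite polynomial `h_m = He_m / √(m!)`,
orthonormal w.r.t. the standard Gaussian measure. -/
def hermiteFn (m : ℕ) (x : ℝ) : ℝ :=
  Polynomial.aeval x (Polynomial.hermite m) / Real.sqrt (Nat.factorial m)

/-- The law of a family of i.i.d. standard Gaussians over a finite index set. -/
def gaussianPi (ι : Type*) [Fintype ι] : Measure (ι → ℝ) :=
  Measure.pi fun _ => gaussianReal 0 1

instance (ι : Type*) [Fintype ι] : IsProbabilityMeasure (gaussianPi ι) := by
  unfold gaussianPi; infer_instance

/-- Tensorized normalized Hermite polynomial `h_n(x) = ∏_e h_{n_e}(x_e)`. -/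
def hermiteProd {ι : Type*} [Fintype ι] (n : ι → ℕ) (x : ι → ℝ) : ℝ :=
  ∏ e, hermiteFn (n e) (x e)

/-- Continuous perturbation `J(t) = e^{-t} J + √(1-e^{-2t}) J'` of the disorder. -/
def contPerturb {ι : Type*} (t : ℝ) (J J' : ι → ℝ) : ι → ℝ := fun e =>
  Real.exp (-t) * J e + Real.sqrt (1 - Real.exp (-2 * t)) * J' e

/-- Discrete perturbation `J(t)_e = B_e J_e + (1-B_e) J'_e` of the disorder. -/
def discPerturb {ι : Type*} (J J' : ι → ℝ) (B : ι → Bool) : ι → ℝ := fun e =>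
  if B e then J e else J' e

/-- Bernoulli measure on `Bool` with success probability `p`. -/
def berBool (p : ℝ) : Measure Bool :=
  ENNReal.ofReal p • Measure.dirac true + ENNReal.ofReal (1 - p) • Measure.dirac false

instance (p : ℝ) : IsFiniteMeasure (berBool p) := by
  constructor
  simp only [berBool, Measure.coe_add, Pi.add_apply, Measure.smul_apply, smul_eq_mul,
    Measure.dirac_apply' _ MeasurableSet.univ, Set.indicator_univ, Pi.one_apply, mul_one]
  exact ENNReal.add_lt_top.mpr ⟨ENNReal.ofReal_lt_top, ENNReal.ofReal_lt_top⟩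

/-- Product Gaussian measure for a pair `(J, J')` of independent disorders. -/
def pairGauss (ι : Type*) [Fintype ι] : Measure ((ι → ℝ) × (ι → ℝ)) :=
  (gaussianPi ι).prod (gaussianPi ι)

/-- Product Gaussian measure for a triple of independent disorders. -/
def tripleGauss (ι : Type*) [Fintype ι] : Measure ((ι → ℝ) × (ι → ℝ) × (ι → ℝ)) :=
  (gaussianPi ι).prod ((gaussianPi ι).prod (gaussianPi ι))

/-- Law of `(J, J', B)`: two independent Gaussian disorders together with i.i.d.
Bernoulli(`p`) variables. -/
def tripleGaussBer (ι : Type*) [Fintype ι] (p : ℝ) :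
    Measure ((ι → ℝ) × (ι → ℝ) × (ι → Bool)) :=
  (gaussianPi ι).prod ((gaussianPi ι).prod (Measure.pi fun _ => berBool p))

/-! ### Spin models on hypergraphs -/

variable {N : ℕ}

/-- `σ_e = ∏_{v ∈ e} σ_v`. -/
def sigEdge (σ : Fin N → Bool) (e : Finset (Fin N)) : ℝ := ∏ v ∈ e, spin (σ v)

/-- Hamiltonian `H_J(σ) = Σ_e ρ_{|e|}(J_e) σ_e` of the short-range model. -/
def ham (Edges : Finset (Finset (Fin N))) (ρ : ℕ → ℝ → ℝ)
    (J : Finset (Fin N) → ℝ) (σ : Fin N → Bool) : ℝ :=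
  ∑ e ∈ Edges, ρ e.card (J e) * sigEdge σ e

/-- Gibbs average of an observable `f` for the Hamiltonian `H` at inverse temperature `β`. -/
def gibbs (β : ℝ) (H : (Fin N → Bool) → ℝ) (f : (Fin N → Bool) → ℝ) : ℝ :=
  (∑ σ : Fin N → Bool, f σ * Real.exp (β * H σ)) / ∑ σ : Fin N → Bool, Real.exp (β * H σ)

/-- Gibbs average of a two-replica observable `f(σ,τ)` where `σ, τ` are sampled from the
product of the Gibbs measures of the Hamiltonians `H₁`, `H₂`. -/
def gibbs2 (β : ℝ) (H₁ H₂ : (Fin N → Bool) → ℝ)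
    (f : (Fin N → Bool) → (Fin N → Bool) → ℝ) : ℝ :=
  (∑ σ : Fin N → Bool, ∑ τ : Fin N → Bool, f σ τ * Real.exp (β * H₁ σ + β * H₂ τ)) /
    ∑ σ : Fin N → Bool, ∑ τ : Fin N → Bool, Real.exp (β * H₁ σ + β * H₂ τ)

/-- Site overlap `R(σ,τ) = N⁻¹ Σ_i σ_i τ_i`. -/
def overlap (σ τ : Fin N → Bool) : ℝ := (∑ i, spin (σ i) * spin (τ i)) / N

/-- Fourier–Hermite coefficient `φ̂_{ij}(n) = E[⟨σ_i σ_j⟩ h_n(J)]` of the two-point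
correlation function. -/
def twoPointCoeff (Edges : Finset (Finset (Fin N))) (ρ : ℕ → ℝ → ℝ) (β : ℝ)
    (i j : Fin N) (n : Finset (Fin N) → ℕ) : ℝ :=
  ∫ ω, gibbs β (ham Edges ρ ω) (fun σ => spin (σ i) * spin (σ j)) * hermiteProd n ω
    ∂gaussianPi (Finset (Fin N))

/-- `E(n) = {e : n_e > 0}`. -/
def Esupp (n : Finset (Fin N) → ℕ) : Finset (Finset (Fin N)) :=
  Finset.univ.filter fun e => n e ≠ 0

/-- `V(n)`: the vertices covered by `E(n)`. -/
def Vsupp (n : Finset (Fin N) → ℕ) : Finset (Fin N) :=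
  (Esupp n).biUnion id

/-- Disorder-averaged two-replica observable under the continuous perturbation:
`E ⟨f(σ,τ)⟩_t` with `σ ~ G_J`, `τ ~ G_{J(t)}`. -/
def contExp (Edges : Finset (Finset (Fin N))) (ρ : ℕ → ℝ → ℝ) (β t : ℝ)
    (f : (Fin N → Bool) → (Fin N → Bool) → ℝ) : ℝ :=
  ∫ ω : (Finset (Fin N) → ℝ) × (Finset (Fin N) → ℝ),
    gibbs2 β (ham Edges ρ ω.1) (ham Edges ρ (contPerturb t ω.1 ω.2)) f
    ∂pairGauss (Finset (Fin N))

/-- Disorder-averaged two-replica observable under the discrete perturbation. -/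
def discExp (Edges : Finset (Finset (Fin N))) (ρ : ℕ → ℝ → ℝ) (β t : ℝ)
    (f : (Fin N → Bool) → (Fin N → Bool) → ℝ) : ℝ :=
  ∫ ω : (Finset (Fin N) → ℝ) × (Finset (Fin N) → ℝ) × (Finset (Fin N) → Bool),
    gibbs2 β (ham Edges ρ ω.1) (ham Edges ρ (discPerturb ω.1 ω.2.1 ω.2.2)) f
    ∂tripleGaussBer (Finset (Fin N)) (Real.exp (-t))

/-! ### Berge paths, distance, balls, cycles -/

/-- `(vs, es)` is a Berge path of length `ℓ` from `v` to `w` in the hypergraph `Edges`. -/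
def IsBergePath (Edges : Finset (Finset (Fin N))) (ℓ : ℕ)
    (vs : Fin (ℓ + 1) → Fin N) (es : Fin ℓ → Finset (Fin N)) (v w : Fin N) : Prop :=
  Function.Injective vs ∧ Function.Injective es ∧ (∀ k, es k ∈ Edges) ∧
    vs 0 = v ∧ vs (Fin.last ℓ) = w ∧
    ∀ k : Fin ℓ, vs k.castSucc ∈ es k ∧ vs k.succ ∈ es k

/-- Hypergraph (Berge) distance between two vertices, `∞` if there is no path. -/
def hdist (Edges : Finset (Finset (Fin N))) (v w : Fin N) : ℕ∞ :=
  sInf {d : ℕ∞ | ∃ (ℓ : ℕ) (vs : Fin (ℓ + 1) → Fin N) (es : Fin ℓ → Finset (Fin N)),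
    IsBergePath Edges ℓ vs es v w ∧ d = (ℓ : ℕ∞)}

open scoped Classical in
/-- The closed ball `B_r(v)` in the hypergraph distance. -/
def hball (Edges : Finset (Finset (Fin N))) (v : Fin N) (r : ℕ) : Finset (Fin N) :=
  Finset.univ.filter fun w => hdist Edges v w ≤ (r : ℕ∞)

/-- The hypergraph `Edges` contains a Berge cycle. -/
def HasBergeCycle (Edges : Finset (Finset (Fin N))) : Prop :=
  ∃ (ℓ : ℕ) (vs : Fin ℓ → Fin N) (es : Fin ℓ → Finset (Fin N)),
    2 ≤ ℓ ∧ Function.Injective vs ∧ Function.Injective es ∧ (∀ k, es k ∈ Edges) ∧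
      ∀ k : Fin ℓ, vs k ∈ es k ∧ vs (finRotate ℓ k) ∈ es k

/-- `min(d, c)` where `d ∈ ℕ∞` and `c ∈ ℝ` (equal to `c` if `d = ∞`). -/
def truncMin (d : ℕ∞) (c : ℝ) : ℝ :=
  if d = ⊤ then c else min (d.toNat : ℝ) c

/-! ### The diluted mixed p-spin random hypergraph -/

/-- Probability that a given hyperedge is present in the diluted model. -/
def edgeProb (α : ℕ → ℝ) (Δ N : ℕ) (e : Finset (Fin N)) : ℝ :=
  if 2 ≤ e.card ∧ e.card ≤ Δ then α e.card * N / (N.choose e.card) else 0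

/-- The law of the diluted mixed `p`-spin random hypergraph: each hyperedge `e` with
`2 ≤ |e| ≤ Δ` is present independently with probability `α_{|e|} N / C(N,|e|)`. -/
def graphMeasure (α : ℕ → ℝ) (Δ N : ℕ) : Measure (Finset (Fin N) → Bool) :=
  Measure.pi fun e => berBool (edgeProb α Δ N e)

/-- The (random) hyperedge set determined by the indicator `g`. -/
def edgesOf {N : ℕ} (Δ : ℕ) (g : Finset (Fin N) → Bool) : Finset (Finset (Fin N)) :=
  Finset.univ.filter fun e => g e = true ∧ 2 ≤ e.card ∧ e.card ≤ Δ

/-- `λ = Σ_p p(p-1) α_p`. -/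
def lamMix (α : ℕ → ℝ) (Δ : ℕ) : ℝ :=
  ∑ p ∈ Finset.Icc 2 Δ, (p : ℝ) * ((p : ℝ) - 1) * α p

/-- `λ' = Σ_p p(p-1)(p-2) α_p`. -/
def lamMix' (α : ℕ → ℝ) (Δ : ℕ) : ℝ :=
  ∑ p ∈ Finset.Icc 2 Δ, (p : ℝ) * ((p : ℝ) - 1) * ((p : ℝ) - 2) * α p

/-- The exploration (breadth-first search) process `(R_t, I_t, S_t, E_t)` of a hypergraph
started at the vertex `i`. -/
def explore {N : ℕ} (Edges : Finset (Finset (Fin N))) (i : Fin N) :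
    ℕ → Finset (Fin N) × Finset (Fin N) × Finset (Fin N) × Finset (Finset (Fin N))
  | 0 => (∅, {i}, Finset.univ.erase i, ∅)
  | t + 1 =>
      let P := explore Edges i t
      let Enew := Edges.filter fun e => (e ∩ P.2.1).Nonempty ∧ e ∩ P.1 = ∅
      (P.1 ∪ P.2.1, Enew.biUnion fun e => e ∩ P.2.2.1,
        P.2.2.1 \ Enew.biUnion fun e => e ∩ P.2.2.1, Enew)

/-- The set `I_t` of newly explored vertices at step `t`. -/
def Iset {N : ℕ} (Edges : Finset (Finset (Fin N))) (i : Fin N) (t : ℕ) : Finset (Fin N) :=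
  (explore Edges i t).2.1

/-- Disorder-and-graph-averaged two-replica observable under the continuous perturbation
in the diluted model. -/
def dilContExp (α : ℕ → ℝ) (Δ N : ℕ) (ρ : ℕ → ℝ → ℝ) (β t : ℝ)
    (f : (Fin N → Bool) → (Fin N → Bool) → ℝ) : ℝ :=
  ∫ ω : (Finset (Fin N) → Bool) × (Finset (Fin N) → ℝ) × (Finset (Fin N) → ℝ),
    gibbs2 β (ham (edgesOf Δ ω.1) ρ ω.2.1)
      (ham (edgesOf Δ ω.1) ρ (contPerturb t ω.2.1 ω.2.2)) f
    ∂((graphMeasure α Δ N).prod (pairGauss (Finset (Fin N))))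

/-- Disorder-and-graph-averaged two-replica observable under the discrete perturbation
in the diluted model. -/
def dilDiscExp (α : ℕ → ℝ) (Δ N : ℕ) (ρ : ℕ → ℝ → ℝ) (β t : ℝ)
    (f : (Fin N → Bool) → (Fin N → Bool) → ℝ) : ℝ :=
  ∫ ω : (Finset (Fin N) → Bool) ×
      (Finset (Fin N) → ℝ) × (Finset (Fin N) → ℝ) × (Finset (Fin N) → Bool),
    gibbs2 β (ham (edgesOf Δ ω.1) ρ ω.2.1)
      (ham (edgesOf Δ ω.1) ρ (discPerturb ω.2.1 ω.2.2.1 ω.2.2.2)) f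
    ∂((graphMeasure α Δ N).prod (tripleGaussBer (Finset (Fin N)) (Real.exp (-t))))

/-! ### The Lévy model -/

/-- Hamiltonian of the Lévy model: `H(σ) = a_N⁻¹ Σ_{i,j} ρ(J_{ij}) σ_i σ_j`. -/
def levyHam (N : ℕ) (aN : ℝ) (ρ : ℝ → ℝ) (J : Fin N × Fin N → ℝ) (σ : Fin N → Bool) : ℝ :=
  (∑ p : Fin N × Fin N, ρ (J p) * (spin (σ p.1) * spin (σ p.2))) / aN

/-- The normalization `a_N = inf{x > 0 : P(|ρ(J)| > x) ≤ 1/N}`. -/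
def levyAN (ρ : ℝ → ℝ) (N : ℕ) : ℝ :=
  sInf {x : ℝ | 0 < x ∧ ((gaussianReal 0 1) {j | x < |ρ j|}).toReal ≤ 1 / N}

/-- The coupled free energy `F_N(t,λ)` of the Lévy model, with the two systems
perturbed by the Ornstein–Uhlenbeck flow at time `t`. -/
def levyF (N : ℕ) (β aN lam : ℝ) (ρ : ℝ → ℝ) (t : ℝ) : ℝ :=
  (∫ ω : (Fin N × Fin N → ℝ) × (Fin N × Fin N → ℝ) × (Fin N × Fin N → ℝ),
      Real.log (∑ σ : Fin N → Bool, ∑ τ : Fin N → Bool,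
        Real.exp (β * levyHam N aN ρ (fun p => Real.exp (-t / 2) * ω.1 p +
              Real.sqrt (1 - Real.exp (-t)) * ω.2.1 p) σ +
          β * levyHam N aN ρ (fun p => Real.exp (-t / 2) * ω.1 p +
              Real.sqrt (1 - Real.exp (-t)) * ω.2.2 p) τ +
          lam * N * overlap σ τ ^ 2))
    ∂tripleGauss (Fin N × Fin N)) / N

/-- The coupled free energy `F_N(∞,λ)`: the two systems carry independent disorders. -/
def levyFinf (N : ℕ) (β aN lam : ℝ) (ρ : ℝ → ℝ) : ℝ :=
  (∫ ω : (Fin N × Fin N → ℝ) × (Fin N × Fin N → ℝ) × (Fin N × Fin N → ℝ),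
      Real.log (∑ σ : Fin N → Bool, ∑ τ : Fin N → Bool,
        Real.exp (β * levyHam N aN ρ ω.2.1 σ + β * levyHam N aN ρ ω.2.2 τ +
          lam * N * overlap σ τ ^ 2))
    ∂tripleGauss (Fin N × Fin N)) / N

/-- `φ(t) = Σ_r E[L_r(J¹(t)) L_r(J²(t))]` where `J^i(t) = e^{-t/2} J + √(1-e^{-t}) J^i`. -/
def phiFn (k m : ℕ) (L : Fin m → (Fin k → ℝ) → ℝ) (t : ℝ) : ℝ :=
  ∑ r : Fin m, ∫ ω : (Fin k → ℝ) × (Fin k → ℝ) × (Fin k → ℝ),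
    L r (fun l => Real.exp (-t / 2) * ω.1 l + Real.sqrt (1 - Real.exp (-t)) * ω.2.1 l) *
      L r (fun l => Real.exp (-t / 2) * ω.1 l + Real.sqrt (1 - Real.exp (-t)) * ω.2.2 l)
    ∂tripleGauss (Fin k)

/-- A law on pairs `(x, y)` of real couplings, symmetric under swapping and under simultaneous sign
change, whose signs are positively correlated and for which `E[y | x] = r x`. -/
structure IsSignCoupling (q : Measure (ℝ × ℝ)) (r : ℝ) : Prop where
  prob : IsProbabilityMeasure q
  swap : MeasurePreserving Prod.swap q q
  neg : MeasurePreserving (fun p : ℝ × ℝ => -p) q q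
  sq : Integrable (fun p : ℝ × ℝ => p.1 ^ 2) q
  pos : ∀ w : ℝ × ℝ → ℝ, Measurable w → (∀ p, 0 ≤ w p) → (∃ C, ∀ p, w p ≤ C) →
    (∀ x y, w (x, -y) = w (x, y)) → 0 ≤ ∫ p, p.1 * p.2 * w p ∂q
  proj : ∀ u : ℝ → ℝ, Measurable u → (∃ C, ∀ x, |u x| ≤ C) →
    ∫ p, p.1 * p.2 * u p.1 ∂q = r * ∫ p, p.1 ^ 2 * u p.1 ∂q

lemma IsSignCoupling.pi_swap {ι : Type*} [Fintype ι] {q : Measure (ℝ × ℝ)}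
    {r : ℝ} (h : IsSignCoupling q r) :
    MeasurePreserving (fun (p : ι → ℝ × ℝ) e => (p e).swap) (Measure.pi fun _ => q)
      (Measure.pi fun _ => q) := by
  have := h.prob
  exact measurePreserving_pi _ _ fun _ => h.swap

/-- Flip the signs of the coordinates of `x` according to `ε`. -/
def flipBy {ι : Type*} (ε : ι → ℤˣ) (x : ι → ℝ) : ι → ℝ := fun e => ((ε e : ℤ) : ℝ) * x e

lemma measurable_flipBy {ι : Type*} (ε : ι → ℤˣ) : Measurable (flipBy ε) :=
  measurable_pi_lambda _ fun e => (measurable_pi_apply e).const_mul _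

lemma flipBy_flipBy {ι : Type*} (ε η : ι → ℤˣ) (x : ι → ℝ) :
    flipBy ε (flipBy η x) = flipBy (ε * η) x := by
  ext e
  simp [flipBy, mul_assoc]

/-- The character `χ_T(ε) = ∏_{e ∈ T} ε_e`. -/
def signChar {ι : Type*} (T : Finset ι) (ε : ι → ℤˣ) : ℝ := ∏ e ∈ T, ((ε e : ℤ) : ℝ)

lemma cast_unit_mul_self (u : ℤˣ) : ((u : ℤ) : ℝ) * ((u : ℤ) : ℝ) = 1 := by
  rcases Int.units_eq_one_or u with rfl | rfl <;> simp

lemma signChar_mul_self {ι : Type*} (T : Finset ι) (ε : ι → ℤˣ) :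
    signChar T ε * signChar T ε = 1 := by
  rw [signChar, ← Finset.prod_mul_distrib]
  exact Finset.prod_eq_one fun e _ => cast_unit_mul_self _

lemma IsSignCoupling.pi_flip {ι : Type*} [Fintype ι] {q : Measure (ℝ × ℝ)}
    {r : ℝ} (h : IsSignCoupling q r)
    (ε : ι → ℤˣ) :
    MeasurePreserving (fun (p : ι → ℝ × ℝ) e => ((ε e : ℤ) : ℝ) • p e) (Measure.pi fun _ => q)
      (Measure.pi fun _ => q) := by
  have := h.prob
  refine measurePreserving_pi (f := fun e (x : ℝ × ℝ) => ((ε e : ℤ) : ℝ) • x) _ _ fun e => ?_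
  rcases Int.units_eq_one_or (ε e) with he | he
  · simpa [he] using! MeasurePreserving.id q
  · simpa [he] using h.neg

section Tensor

lemma measurable_update_prod {ι X : Type*} [DecidableEq ι] [MeasurableSpace X] (e : ι) :
    Measurable fun p : (ι → X) × X => Function.update p.1 e p.2 := by
  rw [measurable_pi_iff]
  intro i
  by_cases h : i = e
  · subst h
    simpa using measurable_snd
  · simp only [Function.update_of_ne h]
    exact (measurable_pi_apply i).comp measurable_fst

lemma prod_insert_update {ι X : Type*} [DecidableEq ι] (f : X → ℝ) {a : ι} {T : Finset ι}
    (ha : a ∉ T)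
    (p : ι → X) (x : X) :
    ∏ e ∈ insert a T, f (Function.update p a x e) = f x * ∏ e ∈ T, f (p e) := by
  rw [Finset.prod_insert ha, Function.update_self]
  congr 1
  refine Finset.prod_congr rfl fun e he => ?_
  rw [Function.update_of_ne (fun hea : e = a => ha (hea ▸ he))]

variable {ι : Type*} [Fintype ι] [DecidableEq ι]

/-- Resampling one coordinate preserves a product probability measure. -/
lemma measurePreserving_update {X : Type*} [MeasurableSpace X] (q : Measure X)
    [IsProbabilityMeasure q] (e : ι) :
    MeasurePreserving (fun p : (ι → X) × X => Function.update p.1 e p.2)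
      ((Measure.pi fun _ => q).prod q) (Measure.pi fun _ => q) := by
  refine ⟨measurable_update_prod e, ?_⟩
  symm
  apply Measure.pi_eq
  intro s hs
  rw [Measure.map_apply (measurable_update_prod e) (MeasurableSet.univ_pi hs)]
  have : (fun p : (ι → X) × X => Function.update p.1 e p.2) ⁻¹' (Set.univ.pi s) =
      (Set.univ.pi (Function.update s e Set.univ)) ×ˢ s e := by
    ext p
    simp only [Set.mem_preimage, Set.mem_pi, Set.mem_univ, true_implies, Set.mem_prod]
    constructor
    · intro h
      refine ⟨fun i => ?_, by simpa using h e⟩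
      by_cases hi : i = e
      · subst hi; simp
      · simpa [Function.update_of_ne hi] using h i
    · rintro ⟨h1, h2⟩ i
      by_cases hi : i = e
      · subst hi; simpa using h2
      · simpa [Function.update_of_ne hi] using h1 i
  rw [this, Measure.prod_prod, Measure.pi_pi, ← Finset.mul_prod_erase _ _ (Finset.mem_univ e),
    ← Finset.mul_prod_erase _ (fun i => q (s i)) (Finset.mem_univ e)]
  simp only [Function.update_self, measure_univ, one_mul]
  rw [mul_comm]
  congr 1
  refine Finset.prod_congr rfl fun i hi => ?_
  rw [Function.update_of_ne (Finset.ne_of_mem_erase hi)]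

lemma integral_pi_update {X : Type*} [MeasurableSpace X] (q : Measure X)
    [IsProbabilityMeasure q] (e : ι) {F : (ι → X) → ℝ} (hF : Integrable F (Measure.pi fun _ => q)) :
    ∫ p, F p ∂(Measure.pi fun _ => q) =
      ∫ p, ∫ x, F (Function.update p e x) ∂q ∂(Measure.pi fun _ : ι => q) := by
  have hm := measurePreserving_update (ι := ι) q e
  calc ∫ p, F p ∂(Measure.pi fun _ => q)
      = ∫ z, F (Function.update z.1 e z.2) ∂((Measure.pi fun _ : ι => q).prod q) := by
        rw [← integral_map hm.measurable.aemeasurable (by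
          rw [hm.map_eq]; exact hF.aestronglyMeasurable), hm.map_eq]
    _ = _ := integral_prod _ (hm.integrable_comp_of_integrable hF)

lemma integrable_finset_prod_pi {X : Type*} [MeasurableSpace X] {q : Measure X}
    [IsProbabilityMeasure q] {f : X → ℝ} (hf : Integrable f q) (T : Finset ι) :
    Integrable (fun p : ι → X => ∏ e ∈ T, f (p e)) (Measure.pi fun _ => q) := by
  have := Integrable.fintype_prod (μ := fun _ : ι => q)
    (f := fun e x => if e ∈ T then f x else 1) (fun e => by
      by_cases h : e ∈ T
      · simpa [h] using hf
      · simp [h])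
  convert this using 2 with p
  rw [Finset.prod_ite_mem, Finset.univ_inter]

variable {q : Measure (ℝ × ℝ)} {r : ℝ}

lemma IsSignCoupling.integrable_mul (h : IsSignCoupling q r) :
    Integrable (fun p : ℝ × ℝ => p.1 * p.2) q := by
  have h2 : Integrable (fun p : ℝ × ℝ => p.2 ^ 2) q := h.swap.integrable_comp_of_integrable h.sq
  refine (h.sq.add h2).mono' (by fun_prop) (ae_of_all _ fun p => ?_)
  simp only [Real.norm_eq_abs, Pi.add_apply]
  rw [abs_le]
  constructor <;> nlinarith [sq_nonneg (p.1 + p.2), sq_nonneg (p.1 - p.2)]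

lemma IsSignCoupling.pi_pos (h : IsSignCoupling q r) (T : Finset ι) :
    ∀ w : (ι → ℝ × ℝ) → ℝ, Measurable w → (∀ p, 0 ≤ w p) → (∃ C, ∀ p, w p ≤ C) →
      (∀ e ∈ T, ∀ p, w (Function.update p e ((p e).1, -(p e).2)) = w p) →
      0 ≤ ∫ p, (∏ e ∈ T, (p e).1 * (p e).2) * w p ∂(Measure.pi fun _ => q) := by
  have := h.prob
  induction T using Finset.induction with
  | empty =>
    intro w _ h0 _ _
    exact integral_nonneg fun p => by simpa using h0 p
  | insert a T ha ih =>
    rintro w hw h0 ⟨C, hC⟩ hinv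
    have hintg : Integrable (fun p : ι → ℝ × ℝ => (∏ e ∈ insert a T, (p e).1 * (p e).2) * w p)
        (Measure.pi fun _ => q) :=
      (integrable_finset_prod_pi (f := fun p : ℝ × ℝ => p.1 * p.2) h.integrable_mul _).mul_bdd
        (c := C) hw.aestronglyMeasurable
        (ae_of_all _ fun p => by rw [Real.norm_eq_abs, abs_of_nonneg (h0 p)]; exact hC p)
    rw [integral_pi_update q a hintg]
    have hup := measurable_update_prod (ι := ι) (X := ℝ × ℝ) a
    set W : (ι → ℝ × ℝ) → ℝ := fun p => ∫ x, x.1 * x.2 * w (Function.update p a x) ∂q with hW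
    have key : ∀ p : ι → ℝ × ℝ, ∫ x, (∏ e ∈ insert a T, (Function.update p a x e).1 *
        (Function.update p a x e).2) * w (Function.update p a x) ∂q =
        (∏ e ∈ T, (p e).1 * (p e).2) * W p := by
      intro p
      rw [hW, ← integral_const_mul]
      refine integral_congr_ae (ae_of_all _ fun x => ?_)
      dsimp only
      rw [prod_insert_update (fun x : ℝ × ℝ => x.1 * x.2) ha]
      ring
    simp_rw [key]
    apply ih
    · have : Measurable fun z : (ι → ℝ × ℝ) × (ℝ × ℝ) =>
          z.2.1 * z.2.2 * w (Function.update z.1 a z.2) :=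
        ((measurable_fst.comp measurable_snd).mul (measurable_snd.comp measurable_snd)).mul
          (hw.comp hup)
      exact this.stronglyMeasurable.integral_prod_right'.measurable
    · intro p
      refine h.pos (fun x => w (Function.update p a x))
        (hw.comp (hup.comp (measurable_const.prodMk measurable_id))) (fun _ => h0 _)
        ⟨C, fun _ => hC _⟩ fun x y => ?_
      have := hinv a (Finset.mem_insert_self _ _) (Function.update p a (x, y))
      simpa using this
    · refine ⟨∫ x, |x.1 * x.2| * C ∂q, fun p => ?_⟩
      have hb : Integrable (fun x : ℝ × ℝ => |x.1 * x.2| * C) q := h.integrable_mul.abs.mul_const C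
      refine (le_abs_self _).trans ?_
      refine norm_integral_le_of_norm_le (f := fun x => x.1 * x.2 * w (Function.update p a x)) hb
        (ae_of_all _ fun x => ?_)
      rw [norm_mul, Real.norm_eq_abs, Real.norm_eq_abs, abs_of_nonneg (h0 _)]
      exact mul_le_mul_of_nonneg_left (hC _) (abs_nonneg _)
    · intro e he p
      have hne : e ≠ a := fun hea => ha (hea ▸ he)
      simp only [hW]
      refine integral_congr_ae (ae_of_all _ fun x => ?_)
      dsimp only
      congr 1
      have := hinv e (Finset.mem_insert_of_mem he) (Function.update p a x)
      rw [Function.update_of_ne hne, Function.update_comm hne.symm] at this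
      exact this

lemma IsSignCoupling.pi_proj (h : IsSignCoupling q r) (T : Finset ι) :
    ∀ u : (ι → ℝ) → ℝ, Measurable u → (∃ C, ∀ x, |u x| ≤ C) →
      ∫ p, (∏ e ∈ T, (p e).1 * (p e).2) * u (fun e => (p e).1) ∂(Measure.pi fun _ => q) =
        r ^ T.card *
          ∫ p, (∏ e ∈ T, (p e).1 ^ 2) * u (fun e => (p e).1) ∂(Measure.pi fun _ => q) := by
  have := h.prob
  induction T using Finset.induction with
  | empty => intro u _ _; simp
  | insert a T ha ih =>
    rintro u hu ⟨C, hC⟩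
    have hfst : Measurable fun p : ι → ℝ × ℝ => fun e => (p e).1 :=
      measurable_pi_lambda _ fun e => measurable_fst.comp (measurable_pi_apply e)
    have hintg {f : ℝ × ℝ → ℝ} (hf : Integrable f q) :
        Integrable (fun p : ι → ℝ × ℝ => (∏ e ∈ insert a T, f (p e)) * u (fun e => (p e).1))
          (Measure.pi fun _ => q) :=
      (integrable_finset_prod_pi hf _).mul_bdd (c := C) (hu.comp hfst).aestronglyMeasurable
        (ae_of_all _ fun p => hC _)
    have hupd (p : ι → ℝ × ℝ) (x : ℝ × ℝ) : (fun e => (Function.update p a x e).1) =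
        Function.update (fun e => (p e).1) a x.1 := by
      ext e
      by_cases hea : e = a
      · subst hea; simp
      · simp [Function.update_of_ne hea]
    set U : (ι → ℝ) → ℝ := fun y => ∫ x, x.1 ^ 2 * u (Function.update y a x.1) ∂q with hU
    have key (f : ℝ × ℝ → ℝ) (p : ι → ℝ × ℝ) : ∫ x, (∏ e ∈ insert a T,
        f (Function.update p a x e)) * u (fun e => (Function.update p a x e).1) ∂q =
        (∏ e ∈ T, f (p e)) * ∫ x, f x * u (Function.update (fun e => (p e).1) a x.1) ∂q := by
      rw [← integral_const_mul]
      refine integral_congr_ae (ae_of_all _ fun x => ?_)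
      dsimp only
      rw [prod_insert_update f ha, hupd]
      ring
    have hproj (y : ι → ℝ) : ∫ x, x.1 * x.2 * u (Function.update y a x.1) ∂q = r * U y :=
      h.proj (fun x => u (Function.update y a x))
        (hu.comp ((measurable_update_prod a).comp (measurable_const.prodMk measurable_id)))
        ⟨C, fun _ => hC _⟩
    have hUm : Measurable U := by
      have : Measurable fun z : (ι → ℝ) × (ℝ × ℝ) =>
          z.2.1 ^ 2 * u (Function.update z.1 a z.2.1) :=
        ((measurable_fst.comp measurable_snd).pow_const 2).mul
          (hu.comp ((measurable_update_prod a).comp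
            (measurable_fst.prodMk (measurable_fst.comp measurable_snd))))
      exact this.stronglyMeasurable.integral_prod_right'.measurable
    have hUb : ∃ C, ∀ x, |U x| ≤ C := by
      refine ⟨∫ x, x.1 ^ 2 * C ∂q, fun y => ?_⟩
      refine norm_integral_le_of_norm_le (f := fun x => x.1 ^ 2 * u (Function.update y a x.1))
        (h.sq.mul_const C) (ae_of_all _ fun x => ?_)
      rw [norm_mul, Real.norm_eq_abs, Real.norm_eq_abs, abs_of_nonneg (sq_nonneg _)]
      exact mul_le_mul_of_nonneg_left (hC _) (sq_nonneg _)
    rw [integral_pi_update q a (hintg h.integrable_mul), integral_pi_update q a (hintg h.sq)]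
    simp_rw [key (fun x => x.1 * x.2), key (fun x => x.1 ^ 2), hproj,
      Finset.card_insert_of_notMem ha]
    have e1 : ∀ p : ι → ℝ × ℝ, (∏ e ∈ T, (p e).1 * (p e).2) * (r * U fun e => (p e).1) =
        r * ((∏ e ∈ T, (p e).1 * (p e).2) * U fun e => (p e).1) := fun p => by ring
    simp_rw [e1]
    rw [integral_const_mul, ih U hUm hUb, pow_succ']
    ring

/-- Sign-definite contraction: a function odd in the coordinates of `T` and bounded by a multiple of
`∏_{e ∈ T} x_e` loses a factor `r ^ |T|`. -/
lemma IsSignCoupling.contraction_of_prod_mul (h : IsSignCoupling q r) (T : Finset ι)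
    {g : (ι → ℝ) → ℝ} (hg : Measurable g) (hb : ∃ C, ∀ x, |g x| ≤ C)
    (hinv : ∀ ε x, g (flipBy ε x) = g x) :
    ∫ p, ((∏ e ∈ T, (p e).1) * g (fun e => (p e).1)) * ((∏ e ∈ T, (p e).2) * g (fun e => (p e).2))
        ∂(Measure.pi fun _ => q) ≤
      r ^ T.card * ∫ p, ((∏ e ∈ T, (p e).1) * g (fun e => (p e).1)) ^ 2
        ∂(Measure.pi fun _ => q) := by
  have := h.prob
  obtain ⟨C, hC⟩ := hb
  have hfst : Measurable fun p : ι → ℝ × ℝ => fun e => (p e).1 :=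
    measurable_pi_lambda _ fun e => measurable_fst.comp (measurable_pi_apply e)
  have hsnd : Measurable fun p : ι → ℝ × ℝ => fun e => (p e).2 :=
    measurable_pi_lambda _ fun e => measurable_snd.comp (measurable_pi_apply e)
  have hC0 : 0 ≤ C := (abs_nonneg _).trans (hC 0)
  have hprod : Integrable (fun p : ι → ℝ × ℝ => ∏ e ∈ T, (p e).1 * (p e).2)
      (Measure.pi fun _ => q) :=
    integrable_finset_prod_pi (f := fun p : ℝ × ℝ => p.1 * p.2) h.integrable_mul T
  have hintg {u v : (ι → ℝ × ℝ) → ℝ} (hu : Measurable u) (hv : Measurable v)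
      (hub : ∀ p, |u p| ≤ C) (hvb : ∀ p, |v p| ≤ C) :
      Integrable (fun p : ι → ℝ × ℝ => (∏ e ∈ T, (p e).1 * (p e).2) * (u p * v p))
        (Measure.pi fun _ => q) :=
    hprod.mul_bdd (c := C * C) (hu.mul hv).aestronglyMeasurable (ae_of_all _ fun p => by
      rw [norm_mul]; exact mul_le_mul (hub p) (hvb p) (abs_nonneg _) hC0)
  set gx : (ι → ℝ × ℝ) → ℝ := fun p => g (fun e => (p e).1) with hgx
  set gy : (ι → ℝ × ℝ) → ℝ := fun p => g (fun e => (p e).2) with hgy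
  have hgxm : Measurable gx := hg.comp hfst
  have hgym : Measurable gy := hg.comp hsnd
  have hpos := h.pi_pos T (fun p => (gx p - gy p) ^ 2) ((hgxm.sub hgym).pow_const 2)
    (fun p => sq_nonneg _) ⟨(C + C) ^ 2, fun p => by
      rw [← sq_abs]
      exact pow_le_pow_left₀ (abs_nonneg _)
        ((abs_sub _ _).trans (add_le_add (hC _) (hC _))) 2⟩ (by
      intro e _ p
      have e1 : gx (Function.update p e ((p e).1, -(p e).2)) = gx p := by
        simp only [hgx]
        congr 1
        ext i
        by_cases hi : i = e
        · subst hi; simp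
        · simp [Function.update_of_ne hi]
      have e2 : gy (Function.update p e ((p e).1, -(p e).2)) = gy p := by
        simp only [hgy]
        rw [← hinv (Function.update 1 e (-1)) fun i => (p i).2]
        congr 1
        ext i
        by_cases hi : i = e
        · subst hi; simp [flipBy]
        · simp [flipBy, Function.update_of_ne hi]
      rw [e1, e2])
  have hsw : ∫ p, (∏ e ∈ T, (p e).1 * (p e).2) * (gy p * gy p) ∂(Measure.pi fun _ => q) =
      ∫ p, (∏ e ∈ T, (p e).1 * (p e).2) * (gx p * gx p) ∂(Measure.pi fun _ => q) := by
    have hs := h.pi_swap (ι := ι)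
    conv_rhs => rw [← hs.map_eq]
    rw [integral_map hs.measurable.aemeasurable
      (by
        rw [hs.map_eq]
        exact (hintg hgxm hgxm (fun _ => hC _) fun _ => hC _).aestronglyMeasurable)]
    refine integral_congr_ae (ae_of_all _ fun p => ?_)
    simp only [hgx, hgy, Prod.fst_swap, Prod.snd_swap, mul_comm]
  have hpr := h.pi_proj T (fun x => g x * g x) (hg.mul hg) ⟨C * C, fun x => by
    rw [abs_mul]; exact mul_le_mul (hC _) (hC _) (abs_nonneg _) hC0⟩
  have hxx := hintg hgxm hgxm (fun _ => hC _) fun _ => hC _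
  have hxy := hintg hgxm hgym (fun _ => hC _) fun _ => hC _
  have hyy := hintg hgym hgym (fun _ => hC _) fun _ => hC _
  have hexp : ∫ p, (∏ e ∈ T, (p e).1 * (p e).2) * (gx p - gy p) ^ 2 ∂(Measure.pi fun _ => q) =
      ∫ p, (∏ e ∈ T, (p e).1 * (p e).2) * (gx p * gx p) ∂(Measure.pi fun _ => q) -
        2 * ∫ p, (∏ e ∈ T, (p e).1 * (p e).2) * (gx p * gy p) ∂(Measure.pi fun _ => q) +
      ∫ p, (∏ e ∈ T, (p e).1 * (p e).2) * (gy p * gy p) ∂(Measure.pi fun _ => q) := by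
    have hsub : Integrable (fun p : ι → ℝ × ℝ => (∏ e ∈ T, (p e).1 * (p e).2) * (gx p * gx p) -
        2 * ((∏ e ∈ T, (p e).1 * (p e).2) * (gx p * gy p))) (Measure.pi fun _ => q) :=
      hxx.sub (hxy.const_mul 2)
    rw [← integral_const_mul, ← integral_sub hxx (hxy.const_mul 2),
      ← integral_add hsub hyy]
    refine integral_congr_ae (ae_of_all _ fun p => ?_)
    dsimp only
    ring
  have el : ∀ p : ι → ℝ × ℝ, ((∏ e ∈ T, (p e).1) * gx p) * ((∏ e ∈ T, (p e).2) * gy p) =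
      (∏ e ∈ T, (p e).1 * (p e).2) * (gx p * gy p) := fun p => by
    rw [Finset.prod_mul_distrib]; ring
  have er : ∀ p : ι → ℝ × ℝ, ((∏ e ∈ T, (p e).1) * gx p) ^ 2 =
      (∏ e ∈ T, (p e).1 ^ 2) * (gx p * gx p) := fun p => by
    rw [Finset.prod_pow]; ring
  change ∫ p, ((∏ e ∈ T, (p e).1) * gx p) * ((∏ e ∈ T, (p e).2) * gy p) ∂(Measure.pi fun _ => q) ≤
    r ^ T.card * ∫ p, ((∏ e ∈ T, (p e).1) * gx p) ^ 2 ∂(Measure.pi fun _ => q)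
  simp_rw [el, er]
  rw [hexp, hsw] at hpos
  rw [← hpr]
  linarith

end Tensor

section SignDecomposition

variable {ι : Type*} [Fintype ι] {q : Measure (ℝ × ℝ)} {r : ℝ}

/-- A function with the parity `χ_T` under sign flips contracts by `r ^ |T|`. -/
lemma IsSignCoupling.contraction_of_parity [DecidableEq ι] (h : IsSignCoupling q r) (hr : 0 ≤ r)
    (T : Finset ι) {f : (ι → ℝ) → ℝ} (hf : Measurable f) (hb : ∀ x, |f x| ≤ 1)
    (hodd : ∀ ε x, f (flipBy ε x) = signChar T ε * f x) :
    ∫ p, f (fun e => (p e).1) * f (fun e => (p e).2) ∂(Measure.pi fun _ => q) ≤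
      r ^ T.card * ∫ p, f (fun e => (p e).1) ^ 2 ∂(Measure.pi fun _ => q) := by
  classical
  have := h.prob
  have hfst : Measurable fun p : ι → ℝ × ℝ => fun e => (p e).1 :=
    measurable_pi_lambda _ fun e => measurable_fst.comp (measurable_pi_apply e)
  have hsnd : Measurable fun p : ι → ℝ × ℝ => fun e => (p e).2 :=
    measurable_pi_lambda _ fun e => measurable_snd.comp (measurable_pi_apply e)
  let S : ℕ → Set (ι → ℝ) := fun n => {x | ∀ e ∈ T, 1 / ((n : ℝ) + 1) ≤ |x e|}
  have hS n : MeasurableSet (S n) := by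
    have : S n = ⋂ e ∈ T, {x : ι → ℝ | 1 / ((n : ℝ) + 1) ≤ |x e|} := by
      ext x; simp [S]
    rw [this]
    exact Finset.measurableSet_biInter _ fun e _ =>
      measurableSet_le measurable_const (measurable_pi_apply e).abs
  let g : ℕ → (ι → ℝ) → ℝ := fun n => (S n).indicator fun x => f x / ∏ e ∈ T, x e
  let F : ℕ → (ι → ℝ) → ℝ := fun n => (S n).indicator f
  have hpn (n : ℕ) : (0 : ℝ) < (n : ℝ) + 1 := by positivity
  have hgF n x : (∏ e ∈ T, x e) * g n x = F n x := by
    by_cases hx : x ∈ S n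
    · simp only [g, F, Set.indicator_of_mem hx]
      have : ∏ e ∈ T, x e ≠ 0 := Finset.prod_ne_zero_iff.2 fun e he h0 => by
        have := hx e he
        rw [h0, abs_zero] at this
        exact absurd this (not_le.2 (one_div_pos.2 (hpn n)))
      field_simp
    · simp [g, F, Set.indicator_of_notMem hx]
  have hgm n : Measurable (g n) := (hf.div (by fun_prop)).indicator (hS n)
  have hFm n : Measurable (F n) := hf.indicator (hS n)
  have hFf n x : |F n x| ≤ |f x| := by
    by_cases hx : x ∈ S n
    · simp [F, Set.indicator_of_mem hx]
    · simp [F, Set.indicator_of_notMem hx]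
  have hgb n : ∃ C, ∀ x, |g n x| ≤ C := by
    refine ⟨((n : ℝ) + 1) ^ T.card, fun x => ?_⟩
    by_cases hx : x ∈ S n
    · simp only [g, Set.indicator_of_mem hx]
      rw [abs_div, Finset.abs_prod]
      have hlow : (1 / ((n : ℝ) + 1)) ^ T.card ≤ ∏ e ∈ T, |x e| := by
        rw [← Finset.prod_const]
        exact Finset.prod_le_prod (fun _ _ => (one_div_pos.2 (hpn n)).le) hx
      have h0 : 0 < (1 / ((n : ℝ) + 1)) ^ T.card := by positivity
      calc |f x| / ∏ e ∈ T, |x e| ≤ 1 / (1 / ((n : ℝ) + 1)) ^ T.card :=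
            div_le_div₀ zero_le_one (hb x) h0 hlow
        _ = _ := by simp
    · simp only [g, Set.indicator_of_notMem hx, abs_zero]
      positivity
  have hginv n : ∀ ε x, g n (flipBy ε x) = g n x := by
    intro ε x
    have hiff : flipBy ε x ∈ S n ↔ x ∈ S n := by
      refine forall₂_congr fun e _ => ?_
      rcases Int.units_eq_one_or (ε e) with he | he <;> simp [flipBy, he]
    by_cases hx : x ∈ S n
    · simp only [g, Set.indicator_of_mem hx, Set.indicator_of_mem (hiff.2 hx), hodd]
      have : ∏ e ∈ T, flipBy ε x e = signChar T ε * ∏ e ∈ T, x e := by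
        simp [flipBy, signChar, Finset.prod_mul_distrib]
      rw [this, mul_div_mul_left]
      intro h0
      have := signChar_mul_self T ε
      simp [h0] at this
    · simp only [g, Set.indicator_of_notMem hx, Set.indicator_of_notMem (mt hiff.1 hx)]
  have hlim x : Filter.Tendsto (fun n => F n x) Filter.atTop (nhds (f x)) := by
    by_cases hx : ∃ e ∈ T, x e = 0
    · obtain ⟨e, he, hxe⟩ := hx
      have hfx : f x = 0 := by
        have h1 := hodd (Function.update 1 e (-1)) x
        have h2 : flipBy (Function.update 1 e (-1)) x = x := by
          ext i
          by_cases hi : i = e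
          · subst hi; simp [flipBy, hxe]
          · simp [flipBy, Function.update_of_ne hi]
        have h3 : signChar T (Function.update 1 e (-1)) = -1 := by
          rw [signChar, Finset.prod_eq_single_of_mem e he fun i _ hi => by
            simp [Function.update_of_ne hi]]
          simp
        rw [h2, h3] at h1
        linarith
      have : ∀ n, F n x = f x := fun n => by
        have := hFf n x
        rw [hfx, abs_zero] at this
        rw [hfx, abs_nonpos_iff.1 this]
      simp [this]
    · push Not at hx
      refine tendsto_const_nhds.congr' ?_
      have : ∀ e ∈ T, ∀ᶠ n : ℕ in Filter.atTop, 1 / ((n : ℝ) + 1) ≤ |x e| := fun e he =>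
        (tendsto_one_div_add_atTop_nhds_zero_nat.eventually_lt_const
          (abs_pos.2 (hx e he))).mono fun _ => le_of_lt
      filter_upwards [(Filter.eventually_all_finset T).2 this] with n hn
      exact (Set.indicator_of_mem (show x ∈ S n from hn) f).symm
  have hi2 {u : (ι → ℝ) → ℝ} (hu : Measurable u) (hub : ∀ x, |u x| ≤ 1) :
      Integrable (fun p : ι → ℝ × ℝ => u (fun e => (p e).1) ^ 2) (Measure.pi fun _ => q) :=
    Integrable.of_bound ((hu.comp hfst).pow_const 2).aestronglyMeasurable 1
      (ae_of_all _ fun p => by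
        rw [norm_pow]; exact pow_le_one₀ (norm_nonneg _) (hub _))
  have hF1 n x : |F n x| ≤ 1 := (hFf n x).trans (hb x)
  refine le_of_tendsto (f := fun n => ∫ p, F n (fun e => (p e).1) * F n (fun e => (p e).2)
    ∂(Measure.pi fun _ : ι => q)) (x := Filter.atTop) ?_ (Filter.Eventually.of_forall fun n => ?_)
  · refine tendsto_integral_of_dominated_convergence (fun _ => 1) (fun n =>
      (((hFm n).comp hfst).mul ((hFm n).comp hsnd)).aestronglyMeasurable) (integrable_const _)
      (fun n => ae_of_all _ fun p => ?_) (ae_of_all _ fun p => (hlim _).mul (hlim _))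
    rw [norm_mul]
    exact mul_le_one₀ (hF1 _ _) (norm_nonneg _) (hF1 _ _)
  · have hc := h.contraction_of_prod_mul T (hgm n) (hgb n) (hginv n)
    have e1 : ∀ p : ι → ℝ × ℝ, (∏ e ∈ T, (p e).1) * g n (fun e => (p e).1) =
        F n fun e => (p e).1 := fun p => hgF n fun e => (p e).1
    have e2 : ∀ p : ι → ℝ × ℝ, (∏ e ∈ T, (p e).2) * g n (fun e => (p e).2) =
        F n fun e => (p e).2 := fun p => hgF n fun e => (p e).2
    simp_rw [e1, e2] at hc
    refine hc.trans (mul_le_mul_of_nonneg_left ?_ (pow_nonneg hr _))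
    refine integral_mono (hi2 (hFm n) (hF1 n)) (hi2 hf hb) fun p => ?_
    exact sq_le_sq.2 (hFf n _)

/-- The component of `φ` of parity `χ_T` under sign flips of the coordinates. -/
def signPart [DecidableEq ι] (φ : (ι → ℝ) → ℝ) (T : Finset ι) (x : ι → ℝ) : ℝ :=
  (2 ^ Fintype.card ι)⁻¹ * ∑ ε : ι → ℤˣ, signChar T ε * φ (flipBy ε x)

variable [DecidableEq ι]

lemma signChar_mul {ι : Type*} (T : Finset ι) (ε η : ι → ℤˣ) :
    signChar T (ε * η) = signChar T ε * signChar T η := by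
  simp [signChar, Finset.prod_mul_distrib]

lemma signPart_flipBy (φ : (ι → ℝ) → ℝ) (T : Finset ι) (η : ι → ℤˣ) (x : ι → ℝ) :
    signPart φ T (flipBy η x) = signChar T η * signPart φ T x := by
  simp only [signPart, flipBy_flipBy]
  rw [← Equiv.sum_comp (Equiv.mulRight η) fun ε => signChar T ε * φ (flipBy ε x),
    mul_left_comm, Finset.mul_sum (a := signChar T η)]
  congr 1
  refine Finset.sum_congr rfl fun ε _ => ?_
  rw [Equiv.coe_mulRight, signChar_mul]
  linear_combination -(signChar T ε * φ (flipBy (ε * η) x)) * signChar_mul_self T η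

lemma signPart_eq_zero {φ : (ι → ℝ) → ℝ} {η : ι → ℤˣ} {c : ℝ}
    (hφ : ∀ x, φ (flipBy η x) = c * φ x) {T : Finset ι} (hc : signChar T η ≠ c) (x : ι → ℝ) :
    signPart φ T x = 0 := by
  have h1 := signPart_flipBy φ T η x
  have h2 : signPart φ T (flipBy η x) = c * signPart φ T x := by
    simp only [signPart]
    rw [mul_left_comm, Finset.mul_sum (a := c)]
    congr 1
    refine Finset.sum_congr rfl fun ε _ => ?_
    rw [flipBy_flipBy, mul_comm ε η, ← flipBy_flipBy, hφ]
    ring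
  have : (signChar T η - c) * signPart φ T x = 0 := by linear_combination h2 - h1
  exact (mul_eq_zero.1 this).resolve_left (sub_ne_zero.2 hc)

lemma card_signs : (Fintype.card (ι → ℤˣ) : ℝ) = 2 ^ Fintype.card ι := by
  simp

lemma sum_signChar {ι : Type*} [Fintype ι] (ε : ι → ℤˣ) :
    ∑ T : Finset ι, signChar T ε = if ε = 1 then 2 ^ Fintype.card ι else 0 := by
  have : ∑ T : Finset ι, signChar T ε = ∏ e, (1 + ((ε e : ℤ) : ℝ)) := by
    rw [Finset.prod_one_add, Finset.powerset_univ]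
    rfl
  rw [this]
  split_ifs with hε
  · subst hε
    norm_num
  · obtain ⟨e, he⟩ : ∃ e, ε e ≠ 1 := by
      by_contra! hcon
      exact hε (funext hcon)
    refine Finset.prod_eq_zero (Finset.mem_univ e) ?_
    rw [(Int.units_eq_one_or (ε e)).resolve_left he]
    simp

lemma sum_signPart (φ : (ι → ℝ) → ℝ) (x : ι → ℝ) : ∑ T, signPart φ T x = φ x := by
  simp only [signPart]
  rw [← Finset.mul_sum, Finset.sum_comm]
  simp_rw [← Finset.sum_mul, sum_signChar, ite_mul, zero_mul]
  rw [Finset.sum_ite_eq' Finset.univ (1 : ι → ℤˣ) fun ε => 2 ^ Fintype.card ι * φ (flipBy ε x)]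
  have : flipBy 1 x = x := by ext e; simp [flipBy]
  simp [this]

lemma abs_signChar {ι : Type*} (T : Finset ι) (ε : ι → ℤˣ) : |signChar T ε| = 1 := by
  have h := signChar_mul_self T ε
  rw [← sq, ← sq_abs] at h
  exact (pow_eq_one_iff_of_nonneg (abs_nonneg _) two_ne_zero).1 h

lemma abs_signPart_le {φ : (ι → ℝ) → ℝ} (hb : ∀ x, |φ x| ≤ 1) (T : Finset ι) (x : ι → ℝ) :
    |signPart φ T x| ≤ 1 := by
  rw [signPart, abs_mul, abs_of_nonneg (by positivity : (0 : ℝ) ≤ (2 ^ Fintype.card ι)⁻¹)]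
  rw [inv_mul_le_one₀ (by positivity), ← card_signs]
  refine (Finset.abs_sum_le_sum_abs _ _).trans ?_
  refine (Finset.sum_le_card_nsmul _ _ 1 fun ε _ => ?_).trans_eq (by simp)
  rw [abs_mul, abs_signChar, one_mul]
  exact hb _

lemma measurable_signPart {φ : (ι → ℝ) → ℝ} (hφ : Measurable φ) (T : Finset ι) :
    Measurable (signPart φ T) :=
  (Finset.measurable_sum _ fun ε _ => (hφ.comp (measurable_flipBy ε)).const_mul _).const_mul _

lemma signChar_update {ι : Type*} [DecidableEq ι] {T : Finset ι} (e : ι) :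
    signChar T (Function.update 1 e (-1)) = if e ∈ T then -1 else 1 := by
  split_ifs with he
  · rw [signChar, Finset.prod_eq_single_of_mem e he fun i _ hi => by
      simp [Function.update_of_ne hi]]
    simp
  · refine Finset.prod_eq_one fun i hi => ?_
    rw [Function.update_of_ne (fun hie : i = e => he (hie ▸ hi))]
    simp

lemma IsSignCoupling.integral_parity_mul_eq_zero (h : IsSignCoupling q r)
    {T T' : Finset ι} (hT : T ≠ T') {G : (ι → ℝ × ℝ) → ℝ} (hGm : Measurable G)
    (hG : ∀ (ε : ι → ℤˣ) p, G (fun e => ((ε e : ℤ) : ℝ) • p e) =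
      signChar T ε * signChar T' ε * G p) :
    ∫ p, G p ∂(Measure.pi fun _ => q) = 0 := by
  have := h.prob
  obtain ⟨e, he⟩ : ∃ e, ¬ (e ∈ T ↔ e ∈ T') := by
    by_contra! hcon
    exact hT (Finset.ext hcon)
  have hs :
      signChar T (Function.update 1 e (-1)) * signChar T' (Function.update 1 e (-1)) = -1 := by
    rw [signChar_update, signChar_update]
    by_cases h1 : e ∈ T <;> by_cases h2 : e ∈ T' <;> simp_all
  have hf := h.pi_flip (Function.update 1 e (-1))
  have : ∫ p, G p ∂(Measure.pi fun _ => q) = -∫ p, G p ∂(Measure.pi fun _ => q) := by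
    conv_lhs => rw [← hf.map_eq]
    rw [integral_map hf.measurable.aemeasurable hGm.aestronglyMeasurable, ← integral_neg]
    simp_rw [hG, hs, neg_one_mul]
  linarith

/-- If all parity components of `φ` on fewer than `d` coordinates vanish, then the coupling reduces
the correlation of `φ` with itself to at most `r ^ d`. -/
lemma IsSignCoupling.integral_mul_le_pow (h : IsSignCoupling q r) (hr : 0 ≤ r) (hr1 : r ≤ 1)
    {φ : (ι → ℝ) → ℝ} (hφ : Measurable φ) (hb : ∀ x, |φ x| ≤ 1) (d : ℕ)
    (hd : ∀ T : Finset ι, T.card < d → ∀ x, signPart φ T x = 0) :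
    ∫ p, φ (fun e => (p e).1) * φ (fun e => (p e).2) ∂(Measure.pi fun _ => q) ≤ r ^ d := by
  have := h.prob
  have hfst : Measurable fun p : ι → ℝ × ℝ => fun e => (p e).1 :=
    measurable_pi_lambda _ fun e => measurable_fst.comp (measurable_pi_apply e)
  have hsnd : Measurable fun p : ι → ℝ × ℝ => fun e => (p e).2 :=
    measurable_pi_lambda _ fun e => measurable_snd.comp (measurable_pi_apply e)
  have hm := measurable_signPart hφ
  have hexp (Y : (ι → ℝ × ℝ) → ι → ℝ) (hY : Measurable Y)
      (hYf : ∀ (ε : ι → ℤˣ) p, Y (fun e => ((ε e : ℤ) : ℝ) • p e) = flipBy ε (Y p)) :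
      ∫ p, φ (fun e => (p e).1) * φ (Y p) ∂(Measure.pi fun _ => q) =
        ∑ T, ∫ p, signPart φ T (fun e => (p e).1) * signPart φ T (Y p)
          ∂(Measure.pi fun _ => q) := by
    have hintg (T T' : Finset ι) : Integrable (fun p : ι → ℝ × ℝ =>
        signPart φ T (fun e => (p e).1) * signPart φ T' (Y p)) (Measure.pi fun _ => q) :=
      Integrable.of_bound (((hm T).comp hfst).mul ((hm T').comp hY)).aestronglyMeasurable 1
        (ae_of_all _ fun p => by
          rw [norm_mul]
          exact mul_le_one₀ (abs_signPart_le hb _ _) (norm_nonneg _) (abs_signPart_le hb _ _))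
    calc ∫ p, φ (fun e => (p e).1) * φ (Y p) ∂(Measure.pi fun _ => q)
        = ∫ p, ∑ T, ∑ T', signPart φ T (fun e => (p e).1) * signPart φ T' (Y p)
            ∂(Measure.pi fun _ => q) := by
          refine integral_congr_ae (ae_of_all _ fun p => ?_)
          dsimp only
          rw [← Finset.sum_mul_sum, sum_signPart, sum_signPart]
      _ = ∑ T, ∑ T', ∫ p, signPart φ T (fun e => (p e).1) * signPart φ T' (Y p)
            ∂(Measure.pi fun _ => q) := by
          rw [integral_finsetSum _ fun T _ => integrable_finsetSum _ fun T' _ => hintg T T']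
          exact Finset.sum_congr rfl fun T _ => integral_finsetSum _ fun T' _ => hintg T T'
      _ = _ := by
          refine Finset.sum_congr rfl fun T _ => ?_
          refine Finset.sum_eq_single T (fun T' _ hT' => ?_) (by simp)
          refine h.integral_parity_mul_eq_zero hT'.symm
            (((hm T).comp hfst).mul ((hm T').comp hY)) fun ε p => ?_
          have : (fun e => (((ε e : ℤ) : ℝ) • p e).1) = flipBy ε fun e => (p e).1 := by
            ext e; simp [flipBy]
          rw [hYf, this, signPart_flipBy, signPart_flipBy]
          ring
  have h1 := hexp _ hsnd fun ε p => by ext e; simp [flipBy]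
  have h2 := hexp _ hfst fun ε p => by ext e; simp [flipBy]
  have h3 : ∫ p, φ (fun e => (p e).1) * φ (fun e => (p e).1) ∂(Measure.pi fun _ : ι => q) ≤ 1 := by
    have := norm_integral_le_of_norm_le_const (μ := Measure.pi fun _ : ι => q) (C := 1)
      (f := fun p => φ (fun e => (p e).1) * φ (fun e => (p e).1)) (ae_of_all _ fun p => by
        rw [norm_mul]; exact mul_le_one₀ (hb _) (norm_nonneg _) (hb _))
    simpa using (le_abs_self _).trans this
  rw [h1]
  calc ∑ T, ∫ p, signPart φ T (fun e => (p e).1) * signPart φ T (fun e => (p e).2)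
          ∂(Measure.pi fun _ => q)
      ≤ ∑ T, r ^ d * ∫ p, signPart φ T (fun e => (p e).1) * signPart φ T (fun e => (p e).1)
          ∂(Measure.pi fun _ => q) := by
        refine Finset.sum_le_sum fun T _ => ?_
        rcases lt_or_ge T.card d with hlt | hge
        · simp [hd T hlt]
        · refine (h.contraction_of_parity hr T (hm T) (abs_signPart_le hb T)
            (signPart_flipBy φ T)).trans ?_
          simp_rw [pow_two]
          exact mul_le_mul_of_nonneg_right (pow_le_pow_of_le_one hr hr1 hge)
            (integral_nonneg fun p => mul_self_nonneg _)
    _ = r ^ d * ∫ p, φ (fun e => (p e).1) * φ (fun e => (p e).1) ∂(Measure.pi fun _ => q) := by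
        rw [← Finset.mul_sum, h2]
    _ ≤ r ^ d := mul_le_of_le_one_right (pow_nonneg hr _) h3

end SignDecomposition

section Couplings

/-- Against an even nonnegative weight, the mean of a Gaussian has the sign of its centre. -/
lemma mul_integral_gaussianReal_nonneg {v : NNReal} (hv : v ≠ 0) (m : ℝ) {f : ℝ → ℝ}
    (hf : ∀ y, 0 ≤ f y) (heven : ∀ y, f (-y) = f y) :
    0 ≤ m * ∫ y, y * f y ∂gaussianReal m v := by
  rw [integral_gaussianReal_eq_integral_smul hv, ← integral_const_mul]
  set G : ℝ → ℝ := fun y => m * (gaussianPDFReal m v y • (y * f y)) with hG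
  by_cases hintg : Integrable G
  · have hneg : ∫ y, G (-y) = ∫ y, G y := integral_neg_eq_self G volume
    have h2 : 2 * ∫ y, G y = ∫ y, (G y + G (-y)) := by
      rw [integral_add hintg hintg.comp_neg, hneg, two_mul]
    have : 0 ≤ ∫ y, (G y + G (-y)) := by
      refine integral_nonneg fun y => ?_
      have hd : G y + G (-y) =
          f y * (m * y * (gaussianPDFReal m v y - gaussianPDFReal m v (-y))) := by
        simp only [hG, heven, smul_eq_mul]
        ring
      simp only [Pi.zero_apply]
      rw [hd]
      refine mul_nonneg (hf y) ?_
      simp only [gaussianPDFReal_def, ← mul_sub]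
      rw [mul_left_comm]
      refine mul_nonneg (by positivity) ?_
      have hv0 : (0 : ℝ) < 2 * v := by
        have : (0 : ℝ) < v := by exact_mod_cast pos_iff_ne_zero.2 hv
        positivity
      rcases le_total 0 (m * y) with hmy | hmy
      · refine mul_nonneg hmy (sub_nonneg.2 (Real.exp_le_exp.2 ?_))
        exact div_le_div_of_nonneg_right (by nlinarith) hv0.le
      · refine mul_nonneg_of_nonpos_of_nonpos hmy (sub_nonpos.2 (Real.exp_le_exp.2 ?_))
        exact div_le_div_of_nonneg_right (by nlinarith) hv0.le
    linarith
  · rw [integral_undef hintg]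

lemma integrable_sq_gaussianReal : Integrable (fun x : ℝ => x ^ 2) (gaussianReal 0 1) :=
  (memLp_id_gaussianReal 2).integrable_sq

/-- The reflection `(x, z) ↦ (r x + s z, s x - r z)` preserves the standard Gaussian. -/
lemma measurePreserving_gaussian_reflection {r s : ℝ} (hrs : r ^ 2 + s ^ 2 = 1) (hs : 0 ≤ s) :
    MeasurePreserving (fun p : ℝ × ℝ => (r * p.1 + s * p.2, s * p.1 - r * p.2))
      ((gaussianReal 0 1).prod (gaussianReal 0 1))
      ((gaussianReal 0 1).prod (gaussianReal 0 1)) := by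
  have h0 : MeasurePreserving (ContinuousLinearMap.rotation (E := ℝ) (Real.arccos r))
      ((gaussianReal 0 1).prod (gaussianReal 0 1)) ((gaussianReal 0 1).prod (gaussianReal 0 1)) :=
    ⟨by fun_prop, IsGaussian.map_rotation_eq_self (by simp) _⟩
  have h1 : MeasurePreserving (fun x : ℝ => -x) (gaussianReal 0 1) (gaussianReal 0 1) :=
    ⟨by fun_prop, by simp [gaussianReal_map_neg]⟩
  have h2 := ((MeasurePreserving.id (gaussianReal 0 1)).prod h1).comp h0
  have hsin : Real.sin (Real.arccos r) = s := by
    rw [Real.sin_arccos, show 1 - r ^ 2 = s ^ 2 by linarith, Real.sqrt_sq hs]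
  have hcos : Real.cos (Real.arccos r) = r :=
    Real.cos_arccos (by nlinarith [sq_nonneg s]) (by nlinarith [sq_nonneg s])
  convert h2 using 1
  ext p
  · simp [ContinuousLinearMap.rotation_apply, hsin, hcos]
  · simp [ContinuousLinearMap.rotation_apply, hsin, hcos]
    ring

/-- The joint law of a standard Gaussian and its Ornstein–Uhlenbeck perturbation. -/
lemma isSignCoupling_gaussian {r s : ℝ} (hrs : r ^ 2 + s ^ 2 = 1) (hr : 0 < r) (hs : 0 < s) :
    IsSignCoupling (((gaussianReal 0 1).prod (gaussianReal 0 1)).map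
      fun p : ℝ × ℝ => (p.1, r * p.1 + s * p.2)) r := by
  set γ := gaussianReal 0 1 with hγ
  set T : ℝ × ℝ → ℝ × ℝ := fun p => (p.1, r * p.1 + s * p.2) with hT
  have hTm : Measurable T := by fun_prop
  have hneg : MeasurePreserving (fun x : ℝ => -x) γ γ :=
    ⟨by fun_prop, by simp [hγ, gaussianReal_map_neg]⟩
  have hi1 : Integrable (fun p : ℝ × ℝ => p.1 ^ 2) (γ.prod γ) :=
    integrable_sq_gaussianReal.comp_fst γ
  have hi2 : Integrable (fun p : ℝ × ℝ => p.2 ^ 2) (γ.prod γ) :=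
    integrable_sq_gaussianReal.comp_snd γ
  have hprob : IsProbabilityMeasure ((γ.prod γ).map T) :=
    Measure.isProbabilityMeasure_map hTm.aemeasurable
  have hmul : Integrable (fun p : ℝ × ℝ => p.1 * (r * p.1 + s * p.2)) (γ.prod γ) := by
    have hxz : Integrable (fun p : ℝ × ℝ => p.1 * p.2) (γ.prod γ) := by
      refine (hi1.add hi2).mono' (by fun_prop) (ae_of_all _ fun p => ?_)
      simp only [Real.norm_eq_abs, Pi.add_apply]
      rw [abs_le]
      constructor <;> nlinarith [sq_nonneg (p.1 + p.2), sq_nonneg (p.1 - p.2)]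
    refine ((hi1.const_mul r).add (hxz.const_mul s)).congr (ae_of_all _ fun p => ?_)
    simp only [Pi.add_apply]
    ring
  refine ⟨hprob, ?_, ?_, ?_, ?_, ?_⟩
  · refine ⟨measurable_swap, ?_⟩
    have hU := measurePreserving_gaussian_reflection hrs hs.le
    rw [Measure.map_map measurable_swap hTm]
    conv_rhs => rw [hγ, ← hU.map_eq, Measure.map_map hTm hU.measurable]
    congr 1
    ext p
    · simp [hT]
    · simp only [hT, Function.comp_apply, Prod.snd_swap]
      linear_combination (-p.1) * hrs
  · refine ⟨measurable_neg, ?_⟩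
    have hN := hneg.prod hneg
    rw [Measure.map_map measurable_neg hTm]
    conv_rhs => rw [← hN.map_eq, Measure.map_map hTm hN.measurable]
    congr 1
    ext p
    · simp [hT]
    · simp only [hT, Function.comp_apply, Prod.snd_neg, Prod.map]
      ring
  · exact (integrable_map_measure (by fun_prop) hTm.aemeasurable).2 hi1
  · rintro w hw h0 ⟨C, hC⟩ heven
    rw [integral_map hTm.aemeasurable (by fun_prop)]
    have hintg : Integrable (fun p : ℝ × ℝ => (T p).1 * (T p).2 * w (T p)) (γ.prod γ) :=
      hmul.mul_bdd (c := C) (hw.comp hTm).aestronglyMeasurable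
        (ae_of_all _ fun p => by rw [Real.norm_eq_abs, abs_of_nonneg (h0 _)]; exact hC _)
    rw [integral_prod _ hintg]
    refine integral_nonneg fun x => ?_
    have hlaw : γ.map (fun z => r * x + s * z) =
        gaussianReal (r * x) (NNReal.mk (s ^ 2) (sq_nonneg s)) := by
      have : (fun z => r * x + s * z) = (fun z => r * x + z) ∘ fun z => s * z := rfl
      rw [this, ← Measure.map_map (by fun_prop) (by fun_prop), gaussianReal_map_const_mul,
        gaussianReal_map_const_add]
      simp
    have hv : NNReal.mk (s ^ 2) (sq_nonneg s) ≠ 0 := by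
      rw [← NNReal.coe_ne_zero]
      exact pow_ne_zero 2 hs.ne'
    have key := mul_integral_gaussianReal_nonneg hv (r * x) (f := fun y => w (x, y))
      (fun y => h0 _) (heven x)
    rw [← hlaw, integral_map (by fun_prop) (by fun_prop), mul_assoc, ← integral_const_mul] at key
    have := nonneg_of_mul_nonneg_right key hr
    simp only [Pi.zero_apply]
    refine this.trans_eq (integral_congr_ae (ae_of_all _ fun z => ?_))
    simp only [hT]
    ring
  · rintro u hu ⟨C, hC⟩
    rw [integral_map hTm.aemeasurable (by fun_prop), integral_map hTm.aemeasurable (by fun_prop)]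
    have hintg : Integrable (fun p : ℝ × ℝ => (T p).1 * (T p).2 * u (T p).1) (γ.prod γ) :=
      hmul.mul_bdd (c := C) (hu.comp (measurable_fst.comp hTm)).aestronglyMeasurable
        (ae_of_all _ fun p => hC _)
    have hintg' : Integrable (fun p : ℝ × ℝ => (T p).1 ^ 2 * u (T p).1) (γ.prod γ) :=
      hi1.mul_bdd (c := C) (hu.comp (measurable_fst.comp hTm)).aestronglyMeasurable
        (ae_of_all _ fun p => hC _)
    rw [integral_prod _ hintg, integral_prod _ hintg', ← integral_const_mul]
    refine integral_congr_ae (ae_of_all _ fun x => ?_)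
    have hid : Integrable (fun z : ℝ => z) γ := (memLp_id_gaussianReal 1).integrable le_rfl
    have e : ∀ z : ℝ, x * (r * x + s * z) * u x = r * (x ^ 2 * u x) + (x * s * u x) * z :=
      fun z => by ring
    simp only [hT, e]
    rw [integral_add (integrable_const _) (hid.const_mul _), integral_const_mul (x * s * u x),
      hγ, integral_id_gaussianReal]
    simp

lemma isSignCoupling_diagonal :
    IsSignCoupling ((gaussianReal 0 1).map fun x => (x, x)) 1 := by
  have hD : Measurable fun x : ℝ => (x, x) := by fun_prop
  have hneg : MeasurePreserving (fun x : ℝ => -x) (gaussianReal 0 1) (gaussianReal 0 1) :=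
    ⟨by fun_prop, by simp [gaussianReal_map_neg]⟩
  refine ⟨Measure.isProbabilityMeasure_map hD.aemeasurable, ⟨measurable_swap, ?_⟩,
    ⟨measurable_neg, ?_⟩, ?_, ?_, ?_⟩
  · rw [Measure.map_map measurable_swap hD]
    rfl
  · rw [Measure.map_map measurable_neg hD]
    conv_rhs => rw [← hneg.map_eq, Measure.map_map hD hneg.measurable]
    rfl
  · exact (integrable_map_measure (by fun_prop) hD.aemeasurable).2 integrable_sq_gaussianReal
  · rintro w hw h0 - -
    rw [integral_map hD.aemeasurable (by fun_prop)]
    exact integral_nonneg fun x => mul_nonneg (mul_self_nonneg x) (h0 _)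
  · rintro u hu -
    rw [integral_map hD.aemeasurable (by fun_prop), integral_map hD.aemeasurable (by fun_prop)]
    simp only [one_mul, pow_two]

lemma isSignCoupling_independent :
    IsSignCoupling ((gaussianReal 0 1).prod (gaussianReal 0 1)) 0 := by
  have hneg : MeasurePreserving (fun x : ℝ => -x) (gaussianReal 0 1) (gaussianReal 0 1) :=
    ⟨by fun_prop, by simp [gaussianReal_map_neg]⟩
  refine ⟨inferInstance, Measure.measurePreserving_swap, hneg.prod hneg,
    integrable_sq_gaussianReal.comp_fst _, ?_, ?_⟩
  · rintro w hw - - heven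
    have hN := (MeasurePreserving.id (gaussianReal 0 1)).prod hneg
    have : ∫ p : ℝ × ℝ, p.1 * p.2 * w p ∂((gaussianReal 0 1).prod (gaussianReal 0 1)) =
        -∫ p : ℝ × ℝ, p.1 * p.2 * w p ∂((gaussianReal 0 1).prod (gaussianReal 0 1)) := by
      conv_lhs => rw [← hN.map_eq]
      rw [integral_map hN.measurable.aemeasurable (by fun_prop), ← integral_neg]
      refine integral_congr_ae (ae_of_all _ fun p => ?_)
      simp only [Prod.map, id, heven]
      ring
    linarith
  · rintro u hu -
    have e : ∀ p : ℝ × ℝ, p.1 * p.2 * u p.1 = (p.1 * u p.1) * p.2 := fun p => by ring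
    simp_rw [e]
    rw [integral_prod_mul (fun x : ℝ => x * u x) fun z : ℝ => z, integral_id_gaussianReal]
    simp

lemma IsSignCoupling.mix {q₁ q₂ : Measure (ℝ × ℝ)} {r₁ r₂ p : ℝ} (h₁ : IsSignCoupling q₁ r₁)
    (h₂ : IsSignCoupling q₂ r₂) (hfst : q₁.map Prod.fst = q₂.map Prod.fst)
    (hp0 : 0 ≤ p) (hp1 : p ≤ 1) :
    IsSignCoupling (ENNReal.ofReal p • q₁ + ENNReal.ofReal (1 - p) • q₂)
      (p * r₁ + (1 - p) * r₂) := by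
  have := h₁.prob
  have := h₂.prob
  have hintg {f : ℝ × ℝ → ℝ} (h1 : Integrable f q₁) (h2 : Integrable f q₂) :
      ∫ x, f x ∂(ENNReal.ofReal p • q₁ + ENNReal.ofReal (1 - p) • q₂) =
        p * ∫ x, f x ∂q₁ + (1 - p) * ∫ x, f x ∂q₂ := by
    rw [integral_add_measure (h1.smul_measure ENNReal.ofReal_ne_top)
      (h2.smul_measure ENNReal.ofReal_ne_top), integral_smul_measure, integral_smul_measure,
      ENNReal.toReal_ofReal hp0, ENNReal.toReal_ofReal (by linarith)]
    simp
  refine ⟨⟨?_⟩, ⟨measurable_swap, ?_⟩, ⟨measurable_neg, ?_⟩, ?_, ?_, ?_⟩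
  · simp only [Measure.coe_add, Pi.add_apply, Measure.smul_apply, smul_eq_mul,
      measure_univ, mul_one]
    rw [← ENNReal.ofReal_add hp0 (by linarith)]
    simp
  · rw [Measure.map_add _ _ measurable_swap, Measure.map_smul, Measure.map_smul, h₁.swap.map_eq,
      h₂.swap.map_eq]
  · rw [Measure.map_add _ _ measurable_neg, Measure.map_smul, Measure.map_smul, h₁.neg.map_eq,
      h₂.neg.map_eq]
  · exact (h₁.sq.smul_measure ENNReal.ofReal_ne_top).add_measure
      (h₂.sq.smul_measure ENNReal.ofReal_ne_top)
  · rintro w hw h0 ⟨C, hC⟩ heven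
    have hb {q : Measure (ℝ × ℝ)} : ∀ᵐ x ∂q, ‖w x‖ ≤ C :=
      ae_of_all _ fun x => by rw [Real.norm_eq_abs, abs_of_nonneg (h0 x)]; exact hC x
    rw [hintg (h₁.integrable_mul.mul_bdd hw.aestronglyMeasurable hb)
      (h₂.integrable_mul.mul_bdd hw.aestronglyMeasurable hb)]
    exact add_nonneg (mul_nonneg hp0 (h₁.pos w hw h0 ⟨C, hC⟩ heven))
      (mul_nonneg (by linarith) (h₂.pos w hw h0 ⟨C, hC⟩ heven))
  · rintro u hu ⟨C, hC⟩
    have hm {q : Measure (ℝ × ℝ)} : AEStronglyMeasurable (fun x : ℝ × ℝ => u x.1) q :=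
      (hu.comp measurable_fst).aestronglyMeasurable
    have hb {q : Measure (ℝ × ℝ)} : ∀ᵐ x ∂q, ‖u x.1‖ ≤ C := ae_of_all _ fun x => hC x.1
    rw [hintg (h₁.integrable_mul.mul_bdd hm hb) (h₂.integrable_mul.mul_bdd hm hb),
      hintg (h₁.sq.mul_bdd hm hb) (h₂.sq.mul_bdd hm hb), h₁.proj u hu ⟨C, hC⟩, h₂.proj u hu ⟨C, hC⟩]
    have heq : ∫ x, x.1 ^ 2 * u x.1 ∂q₁ = ∫ x, x.1 ^ 2 * u x.1 ∂q₂ := by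
      have hg : Measurable fun x : ℝ => x ^ 2 * u x := by fun_prop
      rw [← integral_map (f := fun x : ℝ => x ^ 2 * u x) measurable_fst.aemeasurable
        hg.aestronglyMeasurable, hfst, integral_map measurable_fst.aemeasurable
        hg.aestronglyMeasurable]
    rw [heq]
    ring

/-- The joint law of a standard Gaussian and its partial resampling. -/
lemma isSignCoupling_resampling {p : ℝ} (h0 : 0 ≤ p) (h1 : p ≤ 1) :
    IsSignCoupling (((gaussianReal 0 1).prod ((gaussianReal 0 1).prod (berBool p))).map
      fun x : ℝ × ℝ × Bool => (x.1, if x.2.2 then x.1 else x.2.1)) p := by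
  set γ := gaussianReal 0 1 with hγ
  set f : ℝ × ℝ × Bool → ℝ × ℝ := fun x => (x.1, if x.2.2 then x.1 else x.2.1) with hf
  have hfm : Measurable f := measurable_fst.prodMk (Measurable.ite
    (measurable_snd.comp measurable_snd (measurableSet_singleton true)) measurable_fst
    (measurable_fst.comp measurable_snd))
  have hslice (b : Bool) : MeasurePreserving (fun x : ℝ × ℝ => (x.1, x.2, b)) (γ.prod γ)
      (γ.prod (γ.prod (Measure.dirac b))) :=
    (MeasurePreserving.id γ).prod ⟨by fun_prop, (Measure.prod_dirac b).symm⟩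
  have hmix : (γ.prod (γ.prod (berBool p))).map f =
      ENNReal.ofReal p • γ.map (fun x => (x, x)) + ENNReal.ofReal (1 - p) • γ.prod γ := by
    rw [berBool, Measure.prod_add, Measure.prod_smul_right, Measure.prod_smul_right,
      Measure.prod_add, Measure.prod_smul_right, Measure.prod_smul_right,
      Measure.map_add _ _ hfm, Measure.map_smul, Measure.map_smul, ← (hslice true).map_eq,
      ← (hslice false).map_eq, Measure.map_map hfm (hslice true).measurable,
      Measure.map_map hfm (hslice false).measurable]
    congr 2
    · have : f ∘ (fun x : ℝ × ℝ => (x.1, x.2, true)) = (fun x => (x, x)) ∘ Prod.fst := by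
        ext x <;> simp [hf]
      rw [this, ← Measure.map_map (by fun_prop) measurable_fst, Measure.map_fst_prod]
      simp
    · have : f ∘ (fun x : ℝ × ℝ => (x.1, x.2, false)) = id := by
        ext x <;> simp [hf]
      rw [this, Measure.map_id]
  rw [hmix]
  have hfst : (γ.map fun x => (x, x)).map Prod.fst = (γ.prod γ).map Prod.fst := by
    rw [Measure.map_map measurable_fst (by fun_prop), Measure.map_fst_prod]
    simp [Function.comp_def]
  simpa using isSignCoupling_diagonal.mix isSignCoupling_independent hfst h0 h1

end Couplings

section Perturbations

variable {ι : Type*} [Fintype ι]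

lemma measurePreserving_zip {X Y : Type*} [MeasurableSpace X] [MeasurableSpace Y] (μ : Measure X)
    (ν : Measure Y) [SigmaFinite μ] [SigmaFinite ν] :
    MeasurePreserving (fun (ω : (ι → X) × (ι → Y)) e => (ω.1 e, ω.2 e))
      ((Measure.pi fun _ => μ).prod (Measure.pi fun _ => ν)) (Measure.pi fun _ => μ.prod ν) :=
  (measurePreserving_arrowProdEquivProdArrow X Y ι (fun _ => μ) fun _ => ν).symm

/-- The joint law of the disorder and its continuous perturbation is a product of sign couplings. -/
lemma integral_contPerturb_le [DecidableEq ι] {t : ℝ} (ht : 0 < t) {φ : (ι → ℝ) → ℝ}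
    (hφ : Measurable φ) (hb : ∀ x, |φ x| ≤ 1) (d : ℕ)
    (hd : ∀ T : Finset ι, T.card < d → ∀ x, signPart φ T x = 0) :
    ∫ ω : (ι → ℝ) × (ι → ℝ), φ ω.1 * φ (contPerturb t ω.1 ω.2) ∂pairGauss ι ≤
      Real.exp (-t) ^ d := by
  have hs0 : 0 < 1 - Real.exp (-2 * t) := by
    rw [sub_pos, Real.exp_lt_one_iff]
    linarith
  have hq : IsSignCoupling _ (Real.exp (-t)) :=
    isSignCoupling_gaussian (s := √(1 - Real.exp (-2 * t))) (by
      rw [Real.sq_sqrt hs0.le, ← Real.exp_nat_mul]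
      norm_num) (Real.exp_pos _) (Real.sqrt_pos.2 hs0)
  refine le_of_eq_of_le ?_ (hq.integral_mul_le_pow (Real.exp_pos _).le
    (Real.exp_le_one_iff.2 (by linarith)) hφ hb d hd)
  have := hq.prob
  have hP : MeasurePreserving _ (pairGauss ι) _ :=
    (measurePreserving_pi (fun _ : ι => (gaussianReal 0 1).prod (gaussianReal 0 1)) _
      fun _ => (Measurable.measurePreserving (by fun_prop) _ : MeasurePreserving
        (fun p : ℝ × ℝ => (p.1, Real.exp (-t) * p.1 + √(1 - Real.exp (-2 * t)) * p.2)) _ _)).comp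
      (measurePreserving_zip (gaussianReal 0 1) (gaussianReal 0 1))
  rw [← hP.map_eq, integral_map hP.measurable.aemeasurable (by fun_prop)]
  rfl

/-- The joint law of the disorder and its discrete perturbation is a product of sign couplings. -/
lemma integral_discPerturb_le [DecidableEq ι] {t : ℝ} (ht : 0 < t) {φ : (ι → ℝ) → ℝ}
    (hφ : Measurable φ) (hb : ∀ x, |φ x| ≤ 1) (d : ℕ)
    (hd : ∀ T : Finset ι, T.card < d → ∀ x, signPart φ T x = 0) :
    ∫ ω : (ι → ℝ) × (ι → ℝ) × (ι → Bool), φ ω.1 * φ (discPerturb ω.1 ω.2.1 ω.2.2)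
      ∂tripleGaussBer ι (Real.exp (-t)) ≤ Real.exp (-t) ^ d := by
  have hle : Real.exp (-t) ≤ 1 := Real.exp_le_one_iff.2 (by linarith)
  have hq := isSignCoupling_resampling (Real.exp_pos (-t)).le hle
  refine le_of_eq_of_le ?_ (hq.integral_mul_le_pow (Real.exp_pos _).le hle hφ hb d hd)
  have := hq.prob
  have hf : Measurable fun x : ℝ × ℝ × Bool => (x.1, if x.2.2 then x.1 else x.2.1) :=
    measurable_fst.prodMk (Measurable.ite
      (measurable_snd.comp measurable_snd (measurableSet_singleton true)) measurable_fst
      (measurable_fst.comp measurable_snd))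
  have hP : MeasurePreserving _ (tripleGaussBer ι (Real.exp (-t))) _ :=
    ((measurePreserving_pi
      (fun _ : ι => (gaussianReal 0 1).prod ((gaussianReal 0 1).prod (berBool (Real.exp (-t))))) _
      fun _ => hf.measurePreserving _).comp
      (measurePreserving_zip (gaussianReal 0 1) _)).comp
      ((MeasurePreserving.id (gaussianPi ι)).prod
        (measurePreserving_zip (gaussianReal 0 1) (berBool (Real.exp (-t)))))
  rw [← hP.map_eq, integral_map hP.measurable.aemeasurable (by fun_prop)]
  rfl

end Perturbations

section BergeDistance

/-- A set of hyperedges linking `i` to `j` has at least `hdist i j` elements. -/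
lemma hdist_le_card_of_linked {Edges T : Finset (Finset (Fin N))} (hT : T ⊆ Edges) {i j : Fin N}
    (hlink : ∀ S : Set (Fin N), i ∈ S → (∀ e ∈ T, ∀ v ∈ e, v ∈ S → ∀ w ∈ e, w ∈ S) → j ∈ S) :
    hdist Edges i j ≤ (T.card : ℕ∞) := by
  set G : SimpleGraph (Fin N) := SimpleGraph.fromRel fun v w => ∃ e ∈ T, v ∈ e ∧ w ∈ e with hG
  have hadj {v w : Fin N} : G.Adj v w ↔ v ≠ w ∧ ∃ e ∈ T, v ∈ e ∧ w ∈ e := by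
    rw [hG, SimpleGraph.fromRel_adj]
    refine and_congr_right fun _ => or_iff_left_of_imp ?_
    rintro ⟨e, he, hw, hv⟩
    exact ⟨e, he, hv, hw⟩
  have hedge {e : Finset (Fin N)} (he : e ∈ T) {v w : Fin N} (hv : v ∈ e) (hw : w ∈ e) :
      v = w ∨ G.Adj v w := by
    by_cases h : v = w
    · exact Or.inl h
    · exact Or.inr (hadj.2 ⟨h, e, he, hv, hw⟩)
  have hreach : G.Reachable i j := by
    refine hlink {w | G.Reachable i w} (SimpleGraph.Reachable.refl i) fun e he v hv hvS w hw => ?_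
    rcases hedge he hv hw with rfl | h
    · exact hvS
    · exact hvS.trans h.reachable
  obtain ⟨p, hp⟩ := hreach.exists_walk_length_eq_dist
  have hr (k : ℕ) : G.Reachable i (p.getVert k) := ⟨p.take k⟩
  have hdist_vert {k : ℕ} (hk : k ≤ p.length) : G.dist i (p.getVert k) = k := by
    have h1 : G.dist i (p.getVert k) ≤ k :=
      (SimpleGraph.dist_le (p.take k)).trans (by simp)
    have h2 : G.dist (p.getVert k) j ≤ p.length - k :=
      (SimpleGraph.dist_le (p.drop k)).trans (by simp)
    have h3 := (hr k).dist_triangle_left j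
    omega
  have hstep (k : Fin p.length) : ∃ e ∈ T, p.getVert k ∈ e ∧ p.getVert (k + 1) ∈ e :=
    (hadj.1 (p.adj_getVert_succ k.2)).2
  choose es hesT hes0 hes1 using hstep
  have hinj : Function.Injective es := by
    intro a b hab
    wlog hlt : a < b generalizing a b
    · rcases lt_trichotomy a b with h | h | h
      · exact this hab h
      · exact h
      · exact (this hab.symm h).symm
    exfalso
    have h1 : p.getVert (b + 1) ∈ es a := hab ▸ hes1 b
    have ha := hdist_vert a.2.le
    have hb := hdist_vert b.2
    have hlt' : (a : ℕ) < b := hlt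
    rcases hedge (hesT a) (hes0 a) h1 with h | h
    · rw [h, hb] at ha
      omega
    · have := (hr a).dist_triangle_left (p.getVert (b + 1))
      rw [ha, hb, SimpleGraph.dist_eq_one_iff_adj.2 h] at this
      omega
  have hcard : p.length ≤ T.card := by
    have := Finset.card_le_card_of_injOn es (s := Finset.univ) (fun k _ => hesT k) hinj.injOn
    simpa using this
  suffices h : hdist Edges i j ≤ (p.length : ℕ∞) from h.trans (by exact_mod_cast hcard)
  refine sInf_le ⟨p.length, fun k => p.getVert k, es, ⟨?_, hinj, fun k => hT (hesT k), ?_, ?_,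
    fun k => ⟨hes0 k, hes1 k⟩⟩, rfl⟩
  · intro a b hab
    have ha := hdist_vert (Nat.lt_succ_iff.1 a.2)
    have hb := hdist_vert (Nat.lt_succ_iff.1 b.2)
    dsimp only at hab
    rw [hab, hb] at ha
    exact Fin.ext ha.symm
  · simp
  · simp

lemma one_le_hdist {Edges : Finset (Finset (Fin N))} {i j : Fin N} (hij : i ≠ j) :
    1 ≤ hdist Edges i j := by
  refine le_sInf ?_
  rintro _ ⟨ℓ, vs, es, ⟨-, -, -, h0, h1, -⟩, rfl⟩
  rcases Nat.eq_zero_or_pos ℓ with rfl | hℓ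
  · exact absurd (h0.symm.trans h1) hij
  · exact_mod_cast hℓ

end BergeDistance

section Correlations

lemma abs_spin (b : Bool) : |spin b| = 1 := by
  cases b <;> simp [spin]

lemma sum_exp_pos (β : ℝ) (H : (Fin N → Bool) → ℝ) : 0 < ∑ σ, Real.exp (β * H σ) :=
  Finset.sum_pos (fun _ _ => Real.exp_pos _) Finset.univ_nonempty

lemma abs_gibbs_le (β : ℝ) (H : (Fin N → Bool) → ℝ) {f : (Fin N → Bool) → ℝ}
    (hf : ∀ σ, |f σ| ≤ 1) : |gibbs β H f| ≤ 1 := by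
  rw [gibbs, abs_div, abs_of_pos (sum_exp_pos β H), div_le_one (sum_exp_pos β H)]
  refine (Finset.abs_sum_le_sum_abs _ _).trans (Finset.sum_le_sum fun σ _ => ?_)
  rw [abs_mul, Real.abs_exp]
  exact mul_le_of_le_one_left (Real.exp_pos _).le (hf σ)

/-- The two-point correlation `⟨σ_i σ_j⟩` as a function of the disorder. -/
def corr (Edges : Finset (Finset (Fin N))) (ρ : ℕ → ℝ → ℝ) (β : ℝ) (i j : Fin N)
    (J : Finset (Fin N) → ℝ) : ℝ :=
  gibbs β (ham Edges ρ J) fun σ => spin (σ i) * spin (σ j)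

variable {Edges : Finset (Finset (Fin N))} {ρ : ℕ → ℝ → ℝ} {β : ℝ}

lemma abs_corr_le (i j : Fin N) (J : Finset (Fin N) → ℝ) : |corr Edges ρ β i j J| ≤ 1 :=
  abs_gibbs_le _ _ fun σ => by rw [abs_mul, abs_spin, abs_spin, one_mul]

lemma measurable_corr (hρ : ∀ p, Measurable (ρ p)) (i j : Fin N) :
    Measurable (corr Edges ρ β i j) := by
  have hH (σ : Fin N → Bool) : Measurable fun J : Finset (Fin N) → ℝ => ham Edges ρ J σ :=
    Finset.measurable_sum _ fun e _ => ((hρ _).comp (measurable_pi_apply e)).mul_const _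
  exact (Finset.measurable_sum _ fun σ _ => ((hH σ).const_mul β).exp.const_mul _).div
    (Finset.measurable_sum _ fun σ _ => ((hH σ).const_mul β).exp)

/-- Flip the spins of `σ` at the sites where `s = -1`. -/
def gaugeSpin (s : Fin N → ℤˣ) (σ : Fin N → Bool) : Fin N → Bool :=
  fun v => if s v = 1 then σ v else !σ v

lemma gaugeSpin_involutive (s : Fin N → ℤˣ) : Function.Involutive (gaugeSpin s) := by
  intro σ
  ext v
  by_cases h : s v = 1 <;> simp [gaugeSpin, h]

lemma spin_gaugeSpin (s : Fin N → ℤˣ) (σ : Fin N → Bool) (v : Fin N) :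
    spin (gaugeSpin s σ v) = ((s v : ℤ) : ℝ) * spin (σ v) := by
  rcases Int.units_eq_one_or (s v) with h | h <;> cases hσ : σ v <;> simp [gaugeSpin, h, hσ, spin]

lemma ham_gauge (hodd : ∀ p x, ρ p (-x) = - ρ p x) (s : Fin N → ℤˣ) (J : Finset (Fin N) → ℝ)
    (σ : Fin N → Bool) :
    ham Edges ρ (flipBy (fun e => ∏ v ∈ e, s v) J) σ = ham Edges ρ J (gaugeSpin s σ) := by
  refine Finset.sum_congr rfl fun e _ => ?_
  have h1 : sigEdge (gaugeSpin s σ) e = (((∏ v ∈ e, s v : ℤˣ) : ℤ) : ℝ) * sigEdge σ e := by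
    simp only [sigEdge, spin_gaugeSpin, Finset.prod_mul_distrib]
    push_cast
    rfl
  rw [h1]
  rcases Int.units_eq_one_or (∏ v ∈ e, s v) with h | h <;> simp [flipBy, h, hodd]

lemma corr_gauge (hodd : ∀ p x, ρ p (-x) = - ρ p x) (s : Fin N → ℤˣ) (i j : Fin N)
    (J : Finset (Fin N) → ℝ) :
    corr Edges ρ β i j (flipBy (fun e => ∏ v ∈ e, s v) J) =
      ((s i : ℤ) : ℝ) * ((s j : ℤ) : ℝ) * corr Edges ρ β i j J := by
  have hsum (F : (Fin N → Bool) → ℝ) : ∑ σ, F (gaugeSpin s σ) = ∑ σ, F σ :=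
    Equiv.sum_comp (gaugeSpin_involutive s).toPerm F
  simp only [corr, gibbs, ham_gauge hodd]
  rw [hsum fun σ => Real.exp (β * ham Edges ρ J σ), mul_div_assoc', Finset.mul_sum, ← hsum fun σ =>
    spin (σ i) * spin (σ j) * Real.exp (β * ham Edges ρ J (gaugeSpin s σ))]
  congr 1
  refine Finset.sum_congr rfl fun σ _ => ?_
  rw [spin_gaugeSpin, spin_gaugeSpin, gaugeSpin_involutive s σ]
  ring

lemma corr_flip_of_notMem {e : Finset (Fin N)} (he : e ∉ Edges) (i j : Fin N)
    (J : Finset (Fin N) → ℝ) :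
    corr Edges ρ β i j (flipBy (Function.update 1 e (-1)) J) = corr Edges ρ β i j J := by
  have : ham Edges ρ (flipBy (Function.update 1 e (-1)) J) = ham Edges ρ J := by
    ext σ
    refine Finset.sum_congr rfl fun e' he' => ?_
    have hne : e' ≠ e := fun h => he (h ▸ he')
    simp [flipBy, Function.update_of_ne hne]
  rw [corr, this, corr]

/-- The parity components of `⟨σ_i σ_j⟩` vanish on sets of fewer than `hdist i j` hyperedges. -/
lemma signPart_corr_eq_zero (heven : ∀ e ∈ Edges, Even e.card)
    (hodd : ∀ p x, ρ p (-x) = - ρ p x) (i j : Fin N) {T : Finset (Finset (Fin N))}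
    (hT : (T.card : ℕ∞) < hdist Edges i j) (J : Finset (Fin N) → ℝ) :
    signPart (corr Edges ρ β i j) T J = 0 := by
  classical
  by_cases hTE : T ⊆ Edges
  · have hlink : ¬ ∀ S : Set (Fin N), i ∈ S →
        (∀ e ∈ T, ∀ v ∈ e, v ∈ S → ∀ w ∈ e, w ∈ S) → j ∈ S :=
      fun h => absurd (hdist_le_card_of_linked hTE h) (not_le.2 hT)
    push Not at hlink
    obtain ⟨S, hi, hS, hj⟩ := hlink
    set s : Fin N → ℤˣ := fun v => if v ∈ S then -1 else 1 with hs
    refine signPart_eq_zero (η := fun e => ∏ v ∈ e, s v) (corr_gauge hodd s i j) ?_ J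
    have h1 : signChar T (fun e => ∏ v ∈ e, s v) = 1 := by
      refine Finset.prod_eq_one fun e he => ?_
      suffices ∏ v ∈ e, s v = 1 by simp [this]
      by_cases hv : ∃ v ∈ e, v ∈ S
      · obtain ⟨v, hve, hvS⟩ := hv
        rw [Finset.prod_congr rfl fun w hw => if_pos (hS e he v hve hvS w hw), Finset.prod_const]
        exact (heven e (hTE he)).neg_one_pow
      · push Not at hv
        exact Finset.prod_eq_one fun w hw => if_neg (hv w hw)
    rw [h1]
    simp only [hs, if_pos hi, if_neg hj]
    norm_num
  · obtain ⟨e, heT, heE⟩ := Finset.not_subset.1 hTE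
    refine signPart_eq_zero (η := Function.update 1 e (-1)) (c := 1) (fun x => by
      rw [corr_flip_of_notMem heE, one_mul]) ?_ J
    rw [signChar_update, if_pos heT]
    norm_num

lemma gibbs2_mul (H₁ H₂ : (Fin N → Bool) → ℝ) (f g : (Fin N → Bool) → ℝ) :
    gibbs2 β H₁ H₂ (fun σ τ => f σ * g τ) = gibbs β H₁ f * gibbs β H₂ g := by
  simp only [gibbs2, gibbs]
  rw [div_mul_div_comm, Finset.sum_mul_sum, Finset.sum_mul_sum]
  simp only [Real.exp_add]
  congr 1
  exact Finset.sum_congr rfl fun σ _ => Finset.sum_congr rfl fun τ _ => by ring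

lemma gibbs2_sum {κ : Type*} (s : Finset κ) (H₁ H₂ : (Fin N → Bool) → ℝ)
    (f : κ → (Fin N → Bool) → (Fin N → Bool) → ℝ) :
    gibbs2 β H₁ H₂ (fun σ τ => ∑ k ∈ s, f k σ τ) = ∑ k ∈ s, gibbs2 β H₁ H₂ (f k) := by
  simp only [gibbs2, ← Finset.sum_div]
  congr 1
  simp only [Finset.sum_mul]
  rw [Finset.sum_comm (s := s)]
  exact Finset.sum_congr rfl fun σ _ => Finset.sum_comm

lemma gibbs2_overlap_sq (J J' : Finset (Fin N) → ℝ) :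
    gibbs2 β (ham Edges ρ J) (ham Edges ρ J') (fun σ τ => overlap σ τ ^ 2) =
      (∑ i, ∑ j, corr Edges ρ β i j J * corr Edges ρ β i j J') / (N : ℝ) ^ 2 := by
  have h : (fun σ τ : Fin N → Bool => overlap σ τ ^ 2) = fun σ τ => ∑ i, ∑ j,
      (((N : ℝ) ^ 2)⁻¹ * (spin (σ i) * spin (σ j))) * (spin (τ i) * spin (τ j)) := by
    ext σ τ
    rw [overlap, div_pow, sq (∑ i, _), Finset.sum_mul_sum, div_eq_inv_mul, Finset.mul_sum]
    simp only [Finset.mul_sum]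
    exact Finset.sum_congr rfl fun i _ => Finset.sum_congr rfl fun j _ => by ring
  rw [h]
  simp only [gibbs2_sum, gibbs2_mul, Finset.sum_div]
  refine Finset.sum_congr rfl fun i _ => Finset.sum_congr rfl fun j _ => ?_
  simp only [corr, gibbs, mul_assoc ((N : ℝ) ^ 2)⁻¹, ← Finset.mul_sum]
  ring

end Correlations

section Summation

lemma le_shell_sum {Edges : Finset (Finset (Fin N))} {i j : Fin N} {x b : ℝ} (hx0 : 0 ≤ x)
    (hx1 : x ≤ 1) (hb : ∀ d : ℕ, (d : ℕ∞) ≤ hdist Edges i j → b ≤ x ^ d) (M : ℕ) :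
    b ≤ (if j = i then 1 else 0) +
      (∑ r ∈ Finset.range M, if j ∈ hball Edges i (r + 1) then x ^ (r + 1) - x ^ (r + 2) else 0) +
        x ^ (M + 1) := by
  have hnn (r : ℕ) :
      0 ≤ if j ∈ hball Edges i (r + 1) then x ^ (r + 1) - x ^ (r + 2) else 0 := by
    split_ifs
    · exact sub_nonneg.2 (pow_le_pow_of_le_one hx0 hx1 (by omega))
    · exact le_rfl
  by_cases hij : j = i
  · rw [if_pos hij]
    have h1 := hb 0 (by simp)
    have h2 := Finset.sum_nonneg fun r (_ : r ∈ Finset.range M) => hnn r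
    have h3 : 0 ≤ x ^ (M + 1) := pow_nonneg hx0 _
    rw [pow_zero] at h1
    linarith
  · rw [if_neg hij, zero_add]
    induction M with
    | zero =>
      simpa using hb 1 (by exact_mod_cast one_le_hdist fun h => hij h.symm)
    | succ M ih =>
      rw [Finset.sum_range_succ]
      by_cases hj : j ∈ hball Edges i (M + 1)
      · rw [if_pos hj]
        linarith
      · have hd : ((M + 2 : ℕ) : ℕ∞) ≤ hdist Edges i j := by
          simp only [hball, Finset.mem_filter, Finset.mem_univ, true_and, not_le] at hj
          have := Order.add_one_le_of_lt hj
          exact_mod_cast this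
        have h1 := hb _ hd
        have h2 := Finset.sum_nonneg fun r (_ : r ∈ Finset.range M) => hnn r
        have h3 := hnn M
        linarith

lemma rpow_mul_shell_le {A θ t : ℝ} (hA : 0 < A) (hθ : 0 < θ) (ht : 0 < t) (r : ℕ) :
    A * (r : ℝ) ^ θ * (Real.exp (-t) ^ r - Real.exp (-t) ^ (r + 1)) ≤
      2 * A * (2 * θ) ^ θ / t ^ θ * (Real.exp (-(t / 2)) ^ r - Real.exp (-(t / 2)) ^ (r + 1)) := by
  set y := Real.exp (-(t / 2)) with hy
  have hy0 : 0 < y := Real.exp_pos _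
  have hy1 : y ≤ 1 := Real.exp_le_one_iff.2 (by linarith)
  have hxy : Real.exp (-t) = y * y := by
    rw [hy, ← Real.exp_add]
    congr 1
    ring
  have hpow : (r : ℝ) ^ θ * y ^ r ≤ (2 * θ) ^ θ / t ^ θ := by
    have h1 : (r : ℝ) ^ θ = (2 * θ) ^ θ / t ^ θ * (t * r / (2 * θ)) ^ θ := by
      rw [← Real.div_rpow (by positivity) ht.le, ← Real.mul_rpow (by positivity) (by positivity)]
      congr 1
      field_simp
    have h2 : (t * r / (2 * θ)) ^ θ ≤ Real.exp (t * r / 2) := by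
      calc (t * r / (2 * θ)) ^ θ ≤ Real.exp (t * r / (2 * θ)) ^ θ :=
            Real.rpow_le_rpow (by positivity)
              ((le_add_of_nonneg_right zero_le_one).trans (Real.add_one_le_exp _)) hθ.le
        _ = Real.exp (t * r / 2) := by
            rw [← Real.exp_mul]
            congr 1
            field_simp
    have h3 : Real.exp (t * r / 2) * y ^ r = 1 := by
      rw [hy, ← Real.exp_nat_mul, ← Real.exp_add, Real.exp_eq_one_iff]
      ring
    rw [h1, mul_assoc]
    refine mul_le_of_le_one_right (by positivity) ?_
    rw [← h3]
    exact mul_le_mul_of_nonneg_right h2 (by positivity)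
  have e1 : A * (r : ℝ) ^ θ * (Real.exp (-t) ^ r - Real.exp (-t) ^ (r + 1)) =
      (A * (1 + y) * (y ^ r - y ^ (r + 1))) * ((r : ℝ) ^ θ * y ^ r) := by
    rw [hxy]
    ring
  have hd : 0 ≤ y ^ r - y ^ (r + 1) := sub_nonneg.2 (pow_le_pow_of_le_one hy0.le hy1 (by omega))
  rw [e1]
  calc (A * (1 + y) * (y ^ r - y ^ (r + 1))) * ((r : ℝ) ^ θ * y ^ r)
      ≤ (A * 2 * (y ^ r - y ^ (r + 1))) * ((2 * θ) ^ θ / t ^ θ) := by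
        refine mul_le_mul ?_ hpow (by positivity) (by positivity)
        gcongr
        linarith
    _ = _ := by ring

/-- Polynomial volume growth turns exponential decay in the distance into a power of `1 / t`. -/
lemma sum_le_of_volume_growth {Edges : Finset (Finset (Fin N))} {A θ t : ℝ} (hA : 0 < A)
    (hθ : 0 < θ) (ht : 0 < t) (i : Fin N)
    (hvol : ∀ r : ℕ, 1 ≤ r → ((hball Edges i r).card : ℝ) ≤ A * (r : ℝ) ^ θ) {b : Fin N → ℝ}
    (hb : ∀ j, ∀ d : ℕ, (d : ℕ∞) ≤ hdist Edges i j → b j ≤ Real.exp (-t) ^ d) :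
    ∑ j, b j ≤ 1 + 2 * A * (2 * θ) ^ θ / t ^ θ := by
  set x := Real.exp (-t) with hx
  have hx0 : 0 < x := Real.exp_pos _
  have hx1 : x < 1 := Real.exp_lt_one_iff.2 (by linarith)
  set K := 2 * A * (2 * θ) ^ θ / t ^ θ with hK
  have hK0 : 0 ≤ K := by positivity
  set y := Real.exp (-(t / 2)) with hy
  have hy0 : 0 < y := Real.exp_pos _
  have hy1 : y ≤ 1 := Real.exp_le_one_iff.2 (by linarith)
  have hbound (M : ℕ) : ∑ j, b j ≤ 1 + K + N * x ^ (M + 1) := by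
    calc ∑ j, b j ≤ ∑ j, ((if j = i then 1 else 0) + (∑ r ∈ Finset.range M,
          if j ∈ hball Edges i (r + 1) then x ^ (r + 1) - x ^ (r + 2) else 0) + x ^ (M + 1)) :=
          Finset.sum_le_sum fun j _ => le_shell_sum hx0.le hx1.le (hb j) M
      _ = 1 + ∑ r ∈ Finset.range M,
            ((hball Edges i (r + 1)).card : ℝ) * (x ^ (r + 1) - x ^ (r + 2)) +
          N * x ^ (M + 1) := by
          rw [Finset.sum_add_distrib, Finset.sum_add_distrib, Finset.sum_comm]
          simp [mul_sub, Finset.sum_sub_distrib]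
      _ ≤ 1 + ∑ r ∈ Finset.range M, K * (y ^ (r + 1) - y ^ (r + 2)) + N * x ^ (M + 1) := by
          refine add_le_add_left (add_le_add_right (Finset.sum_le_sum fun r _ => ?_) _) _
          refine le_trans (mul_le_mul_of_nonneg_right (hvol (r + 1) (by omega)) ?_)
            (rpow_mul_shell_le hA hθ ht (r + 1))
          exact sub_nonneg.2 (pow_le_pow_of_le_one hx0.le hx1.le (by omega))
      _ ≤ 1 + K + N * x ^ (M + 1) := by
          gcongr
          rw [← Finset.mul_sum, Finset.sum_range_sub' fun r => y ^ (r + 1)]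
          refine mul_le_of_le_one_right hK0 ?_
          have : 0 ≤ y ^ (M + 1) := by positivity
          simp only [zero_add, pow_one]
          linarith
  have hlim : Filter.Tendsto (fun M : ℕ => 1 + K + N * x ^ (M + 1)) Filter.atTop
      (nhds (1 + K + N * 0)) :=
    (((Filter.tendsto_add_atTop_iff_nat 1).2
      (tendsto_pow_atTop_nhds_zero_of_lt_one hx0.le hx1)).const_mul _).const_add _
  rw [mul_zero, add_zero] at hlim
  exact ge_of_tendsto' hlim hbound

end Summation

lemma integral_overlap_sq_le {Edges : Finset (Finset (Fin N))} {ρ : ℕ → ℝ → ℝ} {A θ t β : ℝ}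
    (hN : 1 ≤ N) (hA : 0 < A) (hθ : 0 < θ) (ht : 0 < t) (hρ : ∀ p, Measurable (ρ p))
    (hvol : ∀ r : ℕ, 1 ≤ r → ∀ i : Fin N, ((hball Edges i r).card : ℝ) ≤ A * (r : ℝ) ^ θ)
    {Ω : Type*} [MeasurableSpace Ω] {P : Measure Ω} [IsFiniteMeasure P]
    {X Y : Ω → Finset (Fin N) → ℝ} (hX : Measurable X) (hY : Measurable Y)
    (hdecay : ∀ i j, ∀ d : ℕ, (d : ℕ∞) ≤ hdist Edges i j →
      ∫ ω, corr Edges ρ β i j (X ω) * corr Edges ρ β i j (Y ω) ∂P ≤ Real.exp (-t) ^ d) :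
    ∫ ω, gibbs2 β (ham Edges ρ (X ω)) (ham Edges ρ (Y ω)) (fun σ τ => overlap σ τ ^ 2) ∂P ≤
      1 / N + 2 * A * (2 * θ) ^ θ / (N * t ^ θ) := by
  have hintg (i j : Fin N) :
      Integrable (fun ω => corr Edges ρ β i j (X ω) * corr Edges ρ β i j (Y ω)) P :=
    Integrable.of_bound (((measurable_corr hρ i j).comp hX).mul
      ((measurable_corr hρ i j).comp hY)).aestronglyMeasurable 1 (ae_of_all _ fun ω => by
        rw [norm_mul]
        exact mul_le_one₀ (abs_corr_le _ _ _) (norm_nonneg _) (abs_corr_le _ _ _))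
  have hN0 : (0 : ℝ) < N := by exact_mod_cast hN
  have htθ : 0 < t ^ θ := Real.rpow_pos_of_pos ht θ
  simp only [gibbs2_overlap_sq]
  rw [integral_div, integral_finsetSum _ fun i _ => integrable_finsetSum _ fun j _ => hintg i j]
  simp only [integral_finsetSum _ fun j _ => hintg _ j]
  calc (∑ i, ∑ j, ∫ ω, corr Edges ρ β i j (X ω) * corr Edges ρ β i j (Y ω) ∂P) / (N : ℝ) ^ 2
      ≤ (∑ _i : Fin N, (1 + 2 * A * (2 * θ) ^ θ / t ^ θ)) / (N : ℝ) ^ 2 := by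
        gcongr with i _
        exact sum_le_of_volume_growth hA hθ ht i (fun r hr => hvol r hr i) (hdecay i)
    _ = 1 / N + 2 * A * (2 * θ) ^ θ / (N * t ^ θ) := by
        simp only [Finset.sum_const, Finset.card_univ, Fintype.card_fin, nsmul_eq_mul]
        field_simp

lemma measurable_discPerturb {ι : Type*} :
    Measurable fun ω : (ι → ℝ) × (ι → ℝ) × (ι → Bool) => discPerturb ω.1 ω.2.1 ω.2.2 := by
  refine measurable_pi_lambda _ fun e => ?_
  have hB : Measurable fun ω : (ι → ℝ) × (ι → ℝ) × (ι → Bool) => ω.2.2 e :=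
    (measurable_pi_apply e).comp (measurable_snd.comp measurable_snd)
  exact Measurable.ite (hB (measurableSet_singleton true))
    ((measurable_pi_apply e).comp measurable_fst)
    ((measurable_pi_apply e).comp (measurable_fst.comp measurable_snd))
/-- Under polynomial volume growth `max_i |B_r(i)| ≤ A r^θ`, there is a
constant `C = C(A,θ) > 0` such that for both perturbations and all `t > 0`, `0 ≤ β < ∞`,
`E⟨R(σ,τ)²⟩_t ≤ 1/N + C/(N t^θ)`. -/
theorem stmt7 (A θ : ℝ) (hA : 0 < A) (hθ : 0 < θ) :
    ∃ C > 0, ∀ (N Δ : ℕ), 1 ≤ N → 2 ≤ Δ →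
      ∀ Edges : Finset (Finset (Fin N)),
        (∀ e ∈ Edges, 2 ≤ e.card ∧ e.card ≤ Δ) → (∀ e ∈ Edges, Even e.card) →
      ∀ ρ : ℕ → ℝ → ℝ, (∀ p, Measurable (ρ p)) → (∀ p x, ρ p (-x) = - ρ p x) →
      (∀ r : ℕ, 1 ≤ r → ∀ i : Fin N, ((hball Edges i r).card : ℝ) ≤ A * (r : ℝ) ^ θ) →
      ∀ t β : ℝ, 0 < t → 0 ≤ β →
        contExp Edges ρ β t (fun σ τ => overlap σ τ ^ 2) ≤ 1 / N + C / (N * t ^ θ) ∧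
          discExp Edges ρ β t (fun σ τ => overlap σ τ ^ 2) ≤ 1 / N + C / (N * t ^ θ) := by
  refine ⟨2 * A * (2 * θ) ^ θ, by positivity, ?_⟩
  intro N Δ hN _ Edges _ heven ρ hρ hodd hvol t β ht _
  have hzero (i j : Fin N) (d : ℕ) (hd : (d : ℕ∞) ≤ hdist Edges i j) (T : Finset (Finset (Fin N)))
      (hT : T.card < d) (x : Finset (Fin N) → ℝ) : signPart (corr Edges ρ β i j) T x = 0 :=
    signPart_corr_eq_zero heven hodd i j (lt_of_lt_of_le (by exact_mod_cast hT) hd) x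
  constructor
  · have : IsFiniteMeasure (pairGauss (Finset (Fin N))) := by
      unfold pairGauss
      infer_instance
    exact integral_overlap_sq_le hN hA hθ ht hρ hvol measurable_fst
      (by unfold contPerturb; fun_prop) fun i j d hd => integral_contPerturb_le ht (measurable_corr hρ i j) (abs_corr_le i j) d
        (hzero i j d hd)
  · have : IsFiniteMeasure (tripleGaussBer (Finset (Fin N)) (Real.exp (-t))) := by
      unfold tripleGaussBer
      infer_instance
    exact integral_overlap_sq_le hN hA hθ ht hρ hvol measurable_fst measurable_discPerturb
      fun i j d hd => integral_discPerturb_le ht (measurable_corr hρ i j) (abs_corr_le i j) d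
        (hzero i j d hd)
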